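/- Let q ∈ (0,1), β ∈ ℝ, n,p ∈ ℕ with p < n, and α ∈ (0,1). There exists an absolute constant C > 0 (independent of n, p, q, α, β) such that whenever n − p ≥ 6/(1−q), one has | E(C^q_β H^α; V_{n,p}) − (q^{n−p+1}/(p (n−p+1)^α)) · (2^α/π²) · K_{p,q} · ∫₀^{π/2} t^α sin t dt | ≤ C · q^{n−p+1} / (p (n−p+1) (1−q)^{δ(p)}), where K_{p,q} = ∫₀^{2π} √(1 − 2q^p cos(pt) + q^{2p}) / (1 − 2q cos t + q²) dt and δ(p) = 2 if p = 1 and δ(p) = 3 if p ≥ 2. -/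

import Mathlib

open Real MeasureTheory intervalIntegral

noncomputable section

/-- A modulus of continuity: continuous, nondecreasing, subadditive on `[0,∞)`, vanishing at 0. -/
def IsModulus (ω : ℝ → ℝ) : Prop :=
  ContinuousOn ω (Set.Ici 0) ∧ MonotoneOn ω (Set.Ici 0) ∧
    (∀ s t : ℝ, 0 ≤ s → 0 ≤ t → ω (s + t) ≤ ω s + ω t) ∧ ω 0 = 0

/-- A convex upwards (i.e. concave) modulus of continuity. -/
def IsConcaveModulus (ω : ℝ → ℝ) : Prop :=
  IsModulus ω ∧ ConcaveOn ℝ (Set.Ici 0) ω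

/-- The class `H_ω` of continuous `2π`-periodic functions with modulus of continuity `ω`. -/
def Hclass (ω : ℝ → ℝ) : Set (ℝ → ℝ) :=
  {φ | Continuous φ ∧ (∀ x, φ (x + 2 * π) = φ x) ∧ ∀ s t : ℝ, |φ s - φ t| ≤ ω |s - t|}

/-- The Poisson kernel `P_{q,β}(t) = Σ_{k≥1} q^k cos(kt + βπ/2)`. -/
def Pker (q β t : ℝ) : ℝ :=
  ∑' k : ℕ, q ^ (k + 1) * Real.cos ((k + 1 : ℕ) * t + β * π / 2)

/-- The class `C^q_β H_ω` of Poisson integrals of functions from `H_ω`. -/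
def CqbH (q β : ℝ) (ω : ℝ → ℝ) : Set (ℝ → ℝ) :=
  {f | ∃ A₀ : ℝ, ∃ φ ∈ Hclass ω,
      f = fun x => A₀ + (1 / π) * ∫ t in (0:ℝ)..(2 * π), φ (x + t) * Pker q β t}

/-- Fourier cosine coefficient. -/
def coefA (f : ℝ → ℝ) (j : ℕ) : ℝ := (1 / π) * ∫ t in (0:ℝ)..(2 * π), f t * Real.cos (j * t)

/-- Fourier sine coefficient. -/
def coefB (f : ℝ → ℝ) (j : ℕ) : ℝ := (1 / π) * ∫ t in (0:ℝ)..(2 * π), f t * Real.sin (j * t)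

/-- The `k`-th partial sum of the Fourier series of `f`. -/
def Ssum (f : ℝ → ℝ) (k : ℕ) (x : ℝ) : ℝ :=
  coefA f 0 / 2 +
    ∑ j ∈ Finset.Icc 1 k, (coefA f j * Real.cos (j * x) + coefB f j * Real.sin (j * x))

/-- The de la Vallée Poussin sum `V_{n,p}(f;x) = (1/p) Σ_{k=n-p}^{n-1} S_k(f;x)`. -/
def Vsum (n p : ℕ) (f : ℝ → ℝ) (x : ℝ) : ℝ :=
  (1 / (p : ℝ)) * ∑ k ∈ Finset.Ico (n - p) n, Ssum f k x

/-- `E(N; A) = sup_{f ∈ N} ‖f - A f‖_C`. -/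
def Edev (N : Set (ℝ → ℝ)) (A : (ℝ → ℝ) → ℝ → ℝ) : ℝ :=
  ⨆ f : N, ⨆ x : ℝ, |(f : ℝ → ℝ) x - A f x|

/-- The constant `K_{p,q}`. -/
def Kpq (p : ℕ) (q : ℝ) : ℝ :=
  ∫ t in (0:ℝ)..(2 * π),
    Real.sqrt (1 - 2 * q ^ p * Real.cos (p * t) + q ^ (2 * p)) /
      (1 - 2 * q * Real.cos t + q ^ 2)

/-- `e_m(ω) = ∫₀^{π/2} ω(2t/m) sin t dt`. -/
def eInt (m : ℕ) (ω : ℝ → ℝ) : ℝ := ∫ t in (0:ℝ)..(π / 2), ω (2 * t / m) * Real.sin t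

/-- `δ(p) = 2` if `p = 1`, `δ(p) = 3` otherwise. -/
def δp (p : ℕ) : ℕ := if p = 1 then 2 else 3

/-- `Z_r(u) = 1/√(1 - 2r cos u + r²)`. -/
def Zf (r u : ℝ) : ℝ := 1 / Real.sqrt (1 - 2 * r * Real.cos u + r ^ 2)

/-- `θ_r(u) = arctan(r sin u / (1 - r cos u))`. -/
def θf (r u : ℝ) : ℝ := Real.arctan (r * Real.sin u / (1 - r * Real.cos u))

/-- The complete elliptic integral of the first kind. -/
def ellK (r : ℝ) : ℝ := ∫ t in (0:ℝ)..(π / 2), 1 / Real.sqrt (1 - r ^ 2 * Real.sin t ^ 2)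

/-- `α_q = ⌊3q/(1-q)⌋ + 2`. -/
def αq (q : ℝ) : ℕ := ⌊3 * q / (1 - q)⌋₊ + 2

lemma half_identity (Φ : ℝ → ℝ) (hΦ : Continuous Φ) :
    ∫ s in (0:ℝ)..(2 * π), Φ s * Real.cos s =
      (∫ u in (0:ℝ)..(π/2), (Φ (π/2 - u) - Φ (π/2 + u)) * Real.sin u) +
      ∫ u in (0:ℝ)..(π/2), (Φ (3*π/2 + u) - Φ (3*π/2 - u)) * Real.sin u := by
  have hi : ∀ a b : ℝ, IntervalIntegrable (fun s => Φ s * Real.cos s) volume a b :=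
    fun a b => (by fun_prop : Continuous fun s => Φ s * Real.cos s).intervalIntegrable a b
  have e1 : ∫ s in (0:ℝ)..(2 * π), Φ s * Real.cos s =
      (∫ s in (0:ℝ)..(π/2), Φ s * Real.cos s) + (∫ s in (π/2)..π, Φ s * Real.cos s) +
      (∫ s in π..(3*π/2), Φ s * Real.cos s) + ∫ s in (3*π/2)..(2*π), Φ s * Real.cos s := by
    rw [integral_add_adjacent_intervals (hi _ _) (hi _ _),
      integral_add_adjacent_intervals (hi _ _) (hi _ _),
      integral_add_adjacent_intervals (hi _ _) (hi _ _)]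
  have a1 : ∫ s in (0:ℝ)..(π/2), Φ s * Real.cos s
      = ∫ u in (0:ℝ)..(π/2), Φ (π/2 - u) * Real.sin u := by
    have := intervalIntegral.integral_comp_sub_left (a := 0) (b := π/2)
      (fun s => Φ s * Real.cos s) (π/2)
    simp only [Real.cos_pi_div_two_sub] at this
    rw [this]; congr 1 <;> ring
  have a2 : ∫ s in (π/2)..π, Φ s * Real.cos s
      = - ∫ u in (0:ℝ)..(π/2), Φ (π/2 + u) * Real.sin u := by
    have := intervalIntegral.integral_comp_add_left (a := 0) (b := π/2)
      (fun s => Φ s * Real.cos s) (π/2)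
    have h2 : ∀ u, Real.cos (π/2 + u) = - Real.sin u := fun u => by
      rw [add_comm]; exact Real.cos_add_pi_div_two u
    simp only [h2, mul_neg, intervalIntegral.integral_neg] at this
    rw [this]; congr 1 <;> ring
  have a3 : ∫ s in π..(3*π/2), Φ s * Real.cos s
      = - ∫ u in (0:ℝ)..(π/2), Φ (3*π/2 - u) * Real.sin u := by
    have := intervalIntegral.integral_comp_sub_left (a := 0) (b := π/2)
      (fun s => Φ s * Real.cos s) (3*π/2)
    have h2 : ∀ u, Real.cos (3*π/2 - u) = - Real.sin u := fun u => by
      rw [show 3*π/2 - u = (π/2 - u) + π by ring, Real.cos_add_pi, Real.cos_pi_div_two_sub]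
    simp only [h2, mul_neg, intervalIntegral.integral_neg] at this
    rw [this]; congr 1 <;> ring
  have a4 : ∫ s in (3*π/2)..(2*π), Φ s * Real.cos s
      = ∫ u in (0:ℝ)..(π/2), Φ (3*π/2 + u) * Real.sin u := by
    have := intervalIntegral.integral_comp_add_left (a := 0) (b := π/2)
      (fun s => Φ s * Real.cos s) (3*π/2)
    have h2 : ∀ u, Real.cos (3*π/2 + u) = Real.sin u := fun u => by
      rw [show 3*π/2 + u = (u + π/2) + π by ring, Real.cos_add_pi, Real.cos_add_pi_div_two, neg_neg]
    simp only [h2] at this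
    rw [this]; congr 1 <;> ring
  rw [e1, a1, a2, a3, a4]
  simp only [sub_mul]
  rw [intervalIntegral.integral_sub, intervalIntegral.integral_sub]
  · ring
  all_goals exact Continuous.intervalIntegrable (by fun_prop) _ _

lemma cos_period_bound {α : ℝ} (hα : α ∈ Set.Ioo (0:ℝ) 1) {φ : ℝ → ℝ}
    (hφ : φ ∈ Hclass (fun t => t ^ α)) {m : ℕ} (hm : 1 ≤ m) (a : ℝ) :
    ∫ t in a..(a + 2 * π / m), φ t * Real.cos (m * (t - a)) ≤
      2 / m * eInt m (fun t => t ^ α) := by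
  obtain ⟨hc, -, hω⟩ := hφ
  have hm0 : (0:ℝ) < m := by exact_mod_cast hm
  have e := intervalIntegral.integral_comp_add_div (a := 0) (b := 2 * π)
    (fun t => φ t * Real.cos (m * (t - a))) hm0.ne' a
  have e' : ∀ s, (m:ℝ) * (a + s / m - a) = s := fun s => by field_simp; ring
  simp only [e', zero_div, add_zero, smul_eq_mul] at e
  have hi := half_identity (fun s => φ (a + s / m)) (by fun_prop)
  have hconti : Continuous (fun t : ℝ => (2 * t / m) ^ α * Real.sin t) := by
    refine Continuous.mul (Continuous.rpow_const (by fun_prop) fun _ => Or.inr hα.1.le) (by fun_prop)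
  have key : ∀ c σ : ℝ, |σ| = 1 → ∫ u in (0:ℝ)..(π/2), (φ (a + (c + σ * u) / m) - φ (a + (c - σ * u) / m)) * Real.sin u
      ≤ eInt m (fun t => t ^ α) := by
    intro c σ hσ
    unfold eInt
    apply intervalIntegral.integral_mono_on (by positivity)
    · exact Continuous.intervalIntegrable (by fun_prop) _ _
    · exact hconti.intervalIntegrable _ _
    · intro u hu
      have hs : 0 ≤ Real.sin u := Real.sin_nonneg_of_nonneg_of_le_pi hu.1 (by linarith [hu.2, Real.pi_pos])
      apply mul_le_mul_of_nonneg_right _ hs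
      refine (le_abs_self _).trans ((hω _ _).trans (le_of_eq ?_))
      simp only
      congr 1
      rw [show a + (c + σ * u) / m - (a + (c - σ * u) / m) = σ * (2 * u / m) by ring, abs_mul, hσ, one_mul,
        abs_of_nonneg]
      have := hu.1; positivity
  have k1 := key (π/2) (-1) (by simp)
  have k2 := key (3*π/2) 1 (by simp)
  simp only [neg_mul, one_mul, sub_neg_eq_add, ← sub_eq_add_neg] at k1 k2
  rw [← inv_mul_cancel_left₀ hm0.ne' (∫ t in a..(a + 2 * π / m), φ t * Real.cos (m * (t - a))), ← e, hi,
    inv_mul_eq_div, div_mul_eq_mul_div]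
  gcongr
  linarith

lemma eInt_bounds {α : ℝ} (hα : α ∈ Set.Ioo (0:ℝ) 1) {m : ℕ} (hm : 1 ≤ m) :
    0 ≤ eInt m (fun t => t ^ α) ∧ eInt m (fun t => t ^ α) ≤ 6 := by
  have hm0 : (1:ℝ) ≤ m := by exact_mod_cast hm
  have hconti : Continuous (fun t : ℝ => (2 * t / m) ^ α * Real.sin t) := by
    refine Continuous.mul (Continuous.rpow_const (by fun_prop) fun _ => Or.inr hα.1.le) (by fun_prop)
  have hs : ∀ u ∈ Set.Icc (0:ℝ) (π/2), 0 ≤ Real.sin u := fun u hu =>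
    Real.sin_nonneg_of_nonneg_of_le_pi hu.1 (by linarith [hu.2, Real.pi_pos])
  constructor
  · apply intervalIntegral.integral_nonneg (by positivity)
    intro u hu
    have := hu.1
    exact mul_nonneg (by positivity) (hs u hu)
  · have : eInt m (fun t => t ^ α) ≤ ∫ t in (0:ℝ)..(π/2), π := by
      apply intervalIntegral.integral_mono_on (by positivity) (hconti.intervalIntegrable _ _)
      · exact intervalIntegrable_const
      · intro u hu
        have h0 := hu.1
        have h1 : 2 * u / m ≤ π := by
          rw [div_le_iff₀ (by linarith)]; nlinarith [hu.2, Real.pi_pos]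
        have h2 : (2 * u / m) ^ α ≤ π := by
          calc (2 * u / m) ^ α ≤ π ^ α := Real.rpow_le_rpow (by positivity) h1 hα.1.le
            _ ≤ π ^ (1:ℝ) := Real.rpow_le_rpow_of_exponent_le (by linarith [Real.pi_gt_three]) hα.2.le
            _ = π := by simp
        have h3 := Real.sin_le_one u
        have h4 := hs u hu
        nlinarith [Real.pi_pos]
    rw [intervalIntegral.integral_const] at this
    simp only [smul_eq_mul, sub_zero] at this
    have := Real.pi_lt_d2
    nlinarith [Real.pi_pos]

/-- Abstract amplitude/phase data for the kernel `R cos Y`. -/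
structure PhaseData (m : ℕ) (A B L : ℝ) (R Y Y' : ℝ → ℝ) : Prop where
  hm : 1 ≤ m
  hL0 : 0 ≤ L
  hLm : L ≤ m / 2
  hAL : A * L ≤ B
  R0 : ∀ t, 0 ≤ R t
  RA : ∀ t, R t ≤ A
  Rlip : ∀ s t, |R s - R t| ≤ B * |s - t|
  Rper : ∀ t, R (t + 2 * π) = R t
  Yd : ∀ t, HasDerivAt Y (Y' t) t
  Yc : Continuous Y'
  YL : ∀ t, |Y' t - m| ≤ L
  Yper : ∀ t, Y (t + 2 * π) = Y t + 2 * π * m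

namespace PhaseData

variable {m : ℕ} {A B L : ℝ} {R Y Y' : ℝ → ℝ}

lemma mpos (h : PhaseData m A B L R Y Y') : (0:ℝ) < m := by exact_mod_cast h.hm

lemma A0 (h : PhaseData m A B L R Y Y') : 0 ≤ A := (h.R0 0).trans (h.RA 0)

lemma B0 (h : PhaseData m A B L R Y Y') : 0 ≤ B := (mul_nonneg h.A0 h.hL0).trans h.hAL

lemma Rcont (h : PhaseData m A B L R Y Y') : Continuous R := by
  have : LipschitzWith (Real.toNNReal B) R := LipschitzWith.of_dist_le_mul fun s t => by
    rw [Real.dist_eq, Real.dist_eq, Real.coe_toNNReal _ h.B0]; exact h.Rlip s t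
  exact this.continuous

lemma Ycont (h : PhaseData m A B L R Y Y') : Continuous Y :=
  continuous_iff_continuousAt.2 fun t => (h.Yd t).continuousAt

lemma Ylip (h : PhaseData m A B L R Y Y') (s t : ℝ) :
    |Y s - Y t - m * (s - t)| ≤ L * |s - t| := by
  have hd : ∀ x ∈ Set.univ, HasDerivWithinAt (fun t => Y t - m * t) (Y' x - m) Set.univ x := by
    intro x _
    have := (h.Yd x).sub ((hasDerivAt_id x).const_mul (m:ℝ))
    simp only [mul_one] at this
    exact this.hasDerivWithinAt
  have := convex_univ.norm_image_sub_le_of_norm_hasDerivWithin_le (C := L) hd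
    (fun x _ => h.YL x) (Set.mem_univ t) (Set.mem_univ s)
  simp only [Real.norm_eq_abs] at this
  convert this using 2
  ring

lemma Ymono (h : PhaseData m A B L R Y Y') {s t : ℝ} (hst : s ≤ t) :
    m / 2 * (t - s) ≤ Y t - Y s := by
  have h1 := h.Ylip t s
  rw [abs_of_nonneg (sub_nonneg.2 hst)] at h1
  have h2 := (abs_le.1 h1).1
  have h3 : 0 ≤ t - s := by linarith
  nlinarith [h.hLm]

lemma Yinj (h : PhaseData m A B L R Y Y') {s t : ℝ} (hst : Y s ≤ Y t) : s ≤ t := by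
  by_contra hc
  push Not at hc
  have := h.Ymono hc.le
  have hm := h.mpos
  have : 0 < (m:ℝ) / 2 * (s - t) := by
    apply mul_pos <;> linarith
  linarith

lemma Ysurj (h : PhaseData m A B L R Y Y') (y : ℝ) : ∃ t, Y t = y := by
  have hm := h.mpos
  have hlow : ∃ t, Y t ≤ y := by
    refine ⟨- (|Y 0 - y| * (2 / m)), ?_⟩
    have h1 := h.Ymono (s := - (|Y 0 - y| * (2 / m))) (t := 0) (by
      have : 0 ≤ |Y 0 - y| * (2 / m) := by positivity
      linarith)
    have h2 : (m:ℝ) / 2 * (0 - -(|Y 0 - y| * (2 / m))) = |Y 0 - y| := by field_simp; ring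
    rw [h2] at h1
    linarith [le_abs_self (Y 0 - y)]
  have hhigh : ∃ t, y ≤ Y t := by
    refine ⟨(|Y 0 - y| * (2 / m)), ?_⟩
    have h1 := h.Ymono (s := 0) (t := (|Y 0 - y| * (2 / m))) (by positivity)
    have h2 : (m:ℝ) / 2 * ((|Y 0 - y| * (2 / m)) - 0) = |Y 0 - y| := by field_simp; ring
    rw [h2] at h1
    linarith [neg_abs_le (Y 0 - y)]
  exact mem_range_of_exists_le_of_exists_ge h.Ycont hlow hhigh

lemma partition (h : PhaseData m A B L R Y Y') :
    ∃ t : ℕ → ℝ, (∀ k, Y (t k) = 2 * π * k) ∧ (∀ k, t k ≤ t (k+1)) ∧ t m = t 0 + 2 * π ∧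
      (∀ k, t (k+1) - t k ≤ 4 * π / m) ∧
      (∀ k, |t (k+1) - t k - 2 * π / m| ≤ L * (4 * π) / m ^ 2) := by
  have hm := h.mpos
  choose t ht using fun k : ℕ => h.Ysurj (2 * π * k)
  have hmono : ∀ k, t k ≤ t (k+1) := fun k => h.Yinj (by
    rw [ht, ht]; push_cast; nlinarith [Real.pi_pos])
  have hstep : ∀ k, t (k+1) - t k ≤ 4 * π / m := fun k => by
    have := h.Ymono (hmono k)
    rw [ht, ht] at this
    push_cast at this
    rw [le_div_iff₀ hm]
    linarith
  refine ⟨t, ht, hmono, ?_, hstep, ?_⟩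
  · have : Y (t m) = Y (t 0 + 2 * π) := by rw [h.Yper, ht, ht]; simp
    exact le_antisymm (h.Yinj this.le) (h.Yinj this.ge)
  · intro k
    have h1 := h.Ylip (t (k+1)) (t k)
    rw [ht, ht, abs_of_nonneg (sub_nonneg.2 (hmono k))] at h1
    have h2 : L * (t (k+1) - t k) ≤ L * (4 * π / m) := mul_le_mul_of_nonneg_left (hstep k) h.hL0
    have h3 : |t (k+1) - t k - 2 * π / m| = |2 * π * ((k+1 : ℕ):ℝ) - 2 * π * k - m * (t (k+1) - t k)| / m := by
      rw [eq_div_iff hm.ne', ← abs_of_pos hm, ← abs_mul, abs_of_pos hm, ← abs_neg]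
      congr 1
      push_cast
      field_simp
      ring
    rw [h3, div_le_iff₀ hm]
    refine h1.trans (h2.trans (le_of_eq ?_))
    field_simp

/-- Sum of integrals over the partition equals the integral over the period. -/
lemma sum_partition {F : ℝ → ℝ} (hF : Continuous F) (hp : ∀ x, F (x + 2 * π) = F x) (t : ℕ → ℝ)
    (htm : t m = t 0 + 2 * π) :
    ∑ k ∈ Finset.range m, ∫ x in (t k)..(t (k+1)), F x = ∫ x in (0:ℝ)..(2 * π), F x := by
  rw [intervalIntegral.sum_integral_adjacent_intervals (fun k _ => hF.intervalIntegrable _ _), htm]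
  have := (show Function.Periodic F (2 * π) from hp).intervalIntegral_add_eq (t 0) 0
  simpa using this

lemma Rint_step (h : PhaseData m A B L R Y Y') {a b : ℝ} (hab : a ≤ b) (hb : b - a ≤ 4 * π / m) :
    |(b - a) * R a - ∫ x in a..b, R x| ≤ B * (4 * π / m) ^ 2 := by
  have hm := h.mpos
  have e : (b - a) * R a - ∫ x in a..b, R x = ∫ x in a..b, (R a - R x) := by
    rw [intervalIntegral.integral_sub intervalIntegrable_const (h.Rcont.intervalIntegrable _ _)]
    simp
  rw [e]
  have := intervalIntegral.norm_integral_le_of_norm_le_const (a := a) (b := b) (C := B * (4 * π / m))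
    (f := fun x => R a - R x) (fun x hx => by
      rw [Set.uIoc_of_le hab] at hx
      refine (h.Rlip a x).trans ?_
      apply mul_le_mul_of_nonneg_left _ h.B0
      rw [abs_of_nonpos (by linarith [hx.1])]
      linarith [hx.2])
  rw [Real.norm_eq_abs] at this
  refine this.trans ?_
  rw [abs_of_nonneg (by linarith), pow_two, ← mul_assoc]
  apply mul_le_mul_of_nonneg_left hb
  have := h.B0
  positivity

lemma upper_step (h : PhaseData m A B L R Y Y') {α : ℝ} (hα : α ∈ Set.Ioo (0:ℝ) 1) {φ : ℝ → ℝ}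
    (hφ : φ ∈ Hclass (fun t => t ^ α)) {M : ℝ} (hM : ∀ t, |φ t| ≤ M) {a b : ℝ} (hab : a ≤ b)
    (hb : b - a ≤ 4 * π / m) (hb' : |b - a - 2 * π / m| ≤ L * (4 * π) / m ^ 2) {k : ℕ}
    (ha : Y a = 2 * π * k) :
    ∫ x in a..b, φ x * (R x * Real.cos (Y x)) ≤
      eInt m (fun t => t ^ α) / π * (∫ x in a..b, R x) +
        (2 * M * B * (4 * π) ^ 2 + M * B * (4 * π) + 2 * B * (4 * π)  + 2 * B * (4 * π) ^ 2) / m ^ 2 := by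
  have hm := h.mpos
  have hφc := hφ.1
  have hM0 : 0 ≤ M := (abs_nonneg _).trans (hM 0)
  have hB := h.B0
  have hRc := h.Rcont
  have hYc := h.Ycont
  have ALB : ∀ x, R x * (L * (4 * π) / m ^ 2) ≤ B * (4 * π) / m ^ 2 := by
    intro x
    rw [mul_div_assoc', div_le_div_iff_of_pos_right (by positivity), ← mul_assoc]
    apply mul_le_mul_of_nonneg_right _ (by positivity)
    exact (mul_le_mul_of_nonneg_right (h.RA x) h.hL0).trans h.hAL
  -- freeze amplitude and phase
  have s1 : |(∫ x in a..b, φ x * (R x * Real.cos (Y x))) -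
      ∫ x in a..b, R a * (φ x * Real.cos (m * (x - a)))| ≤ 2 * M * B * (4 * π) ^ 2 / m ^ 2 := by
    rw [← intervalIntegral.integral_sub (Continuous.intervalIntegrable (by fun_prop) _ _)
      (Continuous.intervalIntegrable (by fun_prop) _ _)]
    have := intervalIntegral.norm_integral_le_of_norm_le_const (a := a) (b := b)
      (C := M * (2 * B * (4 * π / m)))
      (f := fun x => φ x * (R x * Real.cos (Y x)) - R a * (φ x * Real.cos (m * (x - a)))) (fun x hx => by
        rw [Set.uIoc_of_le hab] at hx
        rw [Real.norm_eq_abs, show φ x * (R x * Real.cos (Y x)) - R a * (φ x * Real.cos (m * (x - a)))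
          = φ x * ((R x - R a) * Real.cos (Y x) + R a * (Real.cos (Y x) - Real.cos (m * (x - a)))) by ring,
          abs_mul]
        apply mul_le_mul (hM x) _ (abs_nonneg _) hM0
        have hx' : |x - a| ≤ 4 * π / m := by
          rw [abs_of_nonneg (by linarith [hx.1])]; linarith [hx.2]
        have t1 : |(R x - R a) * Real.cos (Y x)| ≤ B * |x - a| := by
          rw [abs_mul]
          calc _ ≤ B * |x - a| * 1 := mul_le_mul (h.Rlip x a) (Real.abs_cos_le_one _) (abs_nonneg _)
                (by positivity)
            _ = _ := mul_one _
        have t2 : |R a * (Real.cos (Y x) - Real.cos (m * (x - a)))| ≤ B * |x - a| := by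
          have ec : Real.cos (m * (x - a)) = Real.cos (m * (x - a) + Y a) := by
            rw [ha, show 2 * π * (k:ℝ) = k * (2 * π) by ring, Real.cos_add_nat_mul_two_pi]
          rw [abs_mul, abs_of_nonneg (h.R0 a), ec]
          have l1 : |Real.cos (Y x) - Real.cos (m * (x - a) + Y a)| ≤ |Y x - (m * (x - a) + Y a)| :=
            Real.abs_cos_sub_cos_le _ _
          have l2 := h.Ylip x a
          rw [show Y x - (m * (x - a) + Y a) = Y x - Y a - m * (x - a) by ring] at l1
          calc R a * _ ≤ A * (L * |x - a|) := mul_le_mul (h.RA a) (l1.trans l2) (abs_nonneg _) h.A0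
            _ = A * L * |x - a| := by ring
            _ ≤ _ := mul_le_mul_of_nonneg_right h.hAL (abs_nonneg _)
        refine (abs_add_le _ _).trans ?_
        have : B * |x - a| ≤ B * (4 * π / m) := mul_le_mul_of_nonneg_left hx' hB
        linarith)
    rw [Real.norm_eq_abs] at this
    refine this.trans ?_
    rw [abs_of_nonneg (by linarith)]
    calc M * (2 * B * (4 * π / m)) * (b - a) ≤ M * (2 * B * (4 * π / m)) * (4 * π / m) :=
          mul_le_mul_of_nonneg_left hb (by positivity)
      _ = _ := by field_simp
  -- change the end point
  have s2 : |(∫ x in a..b, R a * (φ x * Real.cos (m * (x - a)))) -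
      R a * ∫ x in a..(a + 2 * π / m), φ x * Real.cos (m * (x - a))| ≤ M * B * (4 * π) / m ^ 2 := by
    rw [intervalIntegral.integral_const_mul, ← mul_sub, intervalIntegral.integral_interval_sub_left
      (Continuous.intervalIntegrable (by fun_prop) _ _) (Continuous.intervalIntegrable (by fun_prop) _ _),
      abs_mul, abs_of_nonneg (h.R0 a)]
    have := intervalIntegral.norm_integral_le_of_norm_le_const (a := a + 2 * π / m) (b := b)
      (C := M) (f := fun x => φ x * Real.cos (m * (x - a))) (fun x _ => by
        rw [Real.norm_eq_abs, abs_mul]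
        calc _ ≤ M * 1 := mul_le_mul (hM x) (Real.abs_cos_le_one _) (abs_nonneg _) hM0
          _ = M := mul_one _)
    rw [Real.norm_eq_abs, show b - (a + 2 * π / m) = b - a - 2 * π / m by ring] at this
    calc R a * _ ≤ R a * (M * (L * (4 * π) / m ^ 2)) := by
          apply mul_le_mul_of_nonneg_left _ (h.R0 a)
          exact this.trans (mul_le_mul_of_nonneg_left hb' hM0)
      _ = M * (R a * (L * (4 * π) / m ^ 2)) := by ring
      _ ≤ M * (B * (4 * π) / m ^ 2) := mul_le_mul_of_nonneg_left (ALB a) hM0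
      _ = _ := by ring
  have s3 : R a * ∫ x in a..(a + 2 * π / m), φ x * Real.cos (m * (x - a)) ≤
      R a * (2 / m * eInt m (fun t => t ^ α)) :=
    mul_le_mul_of_nonneg_left (cos_period_bound hα hφ h.hm a) (h.R0 a)
  obtain ⟨he0, he6⟩ := eInt_bounds hα h.hm
  set e := eInt m (fun t => t ^ α) with hedef
  have s4 : R a * (2 * π / m) ≤ (∫ x in a..b, R x) + (B * (4 * π) ^ 2 + B * (4 * π)) / m ^ 2 := by
    have r1 := (abs_le.1 (h.Rint_step hab hb)).2
    have r2 := mul_le_mul_of_nonneg_left (neg_le_of_abs_le hb') (h.R0 a)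
    have r3 := ALB a
    have r4 : B * (4 * π / m) ^ 2 = B * (4 * π) ^ 2 / m ^ 2 := by rw [div_pow]; ring
    rw [add_div]
    nlinarith
  have s5 : R a * (2 / m * e) ≤ e / π * (∫ x in a..b, R x) + (2 * B * (4 * π)  + 2 * B * (4 * π) ^ 2) / m ^ 2 := by
    have hpi := Real.pi_gt_three
    have : R a * (2 / m * e) = e / π * (R a * (2 * π / m)) := by field_simp
    rw [this]
    have hep : e / π ≤ 2 := by rw [div_le_iff₀ (by positivity)]; linarith
    calc _ ≤ e / π * ((∫ x in a..b, R x) + (B * (4 * π) ^ 2 + B * (4 * π)) / m ^ 2) :=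
          mul_le_mul_of_nonneg_left s4 (by positivity)
      _ ≤ e / π * (∫ x in a..b, R x) + 2 * ((B * (4 * π) ^ 2 + B * (4 * π)) / m ^ 2) := by
          rw [mul_add]
          gcongr
      _ = _ := by ring
  have e1 := (abs_le.1 s1).2
  have e2 := (abs_le.1 s2).2
  have : (2 * M * B * (4 * π) ^ 2 + M * B * (4 * π) + 2 * B * (4 * π)  + 2 * B * (4 * π) ^ 2) / (m:ℝ) ^ 2
    = 2 * M * B * (4 * π) ^ 2 / m ^ 2 + M * B * (4 * π) / m ^ 2 +
      (2 * B * (4 * π)  + 2 * B * (4 * π) ^ 2) / m ^ 2 := by ring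
  rw [this]
  linarith

lemma Fper (h : PhaseData m A B L R Y Y') (x : ℝ) :
    R (x + 2 * π) * Real.cos (Y (x + 2 * π)) = R x * Real.cos (Y x) := by
  rw [h.Rper, h.Yper, show 2 * π * (m:ℝ) = m * (2 * π) by ring, Real.cos_add_nat_mul_two_pi]

/-- Upper estimate. -/
lemma upper (h : PhaseData m A B L R Y Y') {α : ℝ} (hα : α ∈ Set.Ioo (0:ℝ) 1) {φ : ℝ → ℝ}
    (hφ : φ ∈ Hclass (fun t => t ^ α)) {M : ℝ} (hM : ∀ t, |φ t| ≤ M) :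
    ∫ x in (0:ℝ)..(2 * π), φ x * (R x * Real.cos (Y x)) ≤
      eInt m (fun t => t ^ α) / π * (∫ x in (0:ℝ)..(2 * π), R x) +
        (2 * M * (4 * π) ^ 2 + M * (4 * π) + 2 * (4 * π)  + 2 * (4 * π) ^ 2) * B / m := by
  have hm := h.mpos
  have hφc := hφ.1
  have hRc := h.Rcont
  have hYc := h.Ycont
  obtain ⟨t, ht, hmono, htm, hst, hst'⟩ := h.partition
  rw [← sum_partition (m := m) (F := fun x => φ x * (R x * Real.cos (Y x))) (by fun_prop) (fun x => by
    rw [h.Fper, hφ.2.1]) t htm, ← sum_partition (m := m) hRc h.Rper t htm]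
  refine (Finset.sum_le_sum fun k _ =>
    h.upper_step hα hφ hM (hmono k) (hst k) (hst' k) (ht k)).trans (le_of_eq ?_)
  rw [Finset.sum_add_distrib, ← Finset.mul_sum, Finset.sum_const, Finset.card_range, nsmul_eq_mul]
  congr 1
  field_simp

end PhaseData

/-- odd power function -/
def Gpow (α s : ℝ) : ℝ := (max s 0) ^ α - (max (-s) 0) ^ α

lemma Gpow_cont {α : ℝ} (hα : 0 < α) : Continuous (Gpow α) := by
  unfold Gpow
  exact (Continuous.rpow_const (by fun_prop) fun _ => Or.inr hα.le).sub
    (Continuous.rpow_const (by fun_prop) fun _ => Or.inr hα.le)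

lemma Gpow_nonneg {α s : ℝ} (hα : 0 < α) (hs : 0 ≤ s) : Gpow α s = s ^ α := by
  unfold Gpow
  rw [max_eq_left hs, max_eq_right (by linarith), Real.zero_rpow hα.ne', sub_zero]

lemma Gpow_neg (α s : ℝ) : Gpow α (-s) = - Gpow α s := by
  unfold Gpow; rw [neg_neg]; ring

lemma Gpow_lip_le {α : ℝ} (hα : α ∈ Set.Ioo (0:ℝ) 1) {a b : ℝ} (hab : b ≤ a) :
    |Gpow α a - Gpow α b| ≤ 2 * ((a - b) / 2) ^ α := by
  have hα0 := hα.1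
  have sub : ∀ x y : ℝ, 0 ≤ y → y ≤ x → |x ^ α - y ^ α| ≤ 2 * ((x - y) / 2) ^ α := by
    intro x y hy hxy
    have h1 : y ^ α ≤ x ^ α := Real.rpow_le_rpow hy hxy hα0.le
    rw [abs_of_nonneg (by linarith)]
    have h2 := Real.rpow_add_le_add_rpow (p := α) (sub_nonneg.2 hxy) hy hα0.le hα.2.le
    rw [sub_add_cancel] at h2
    have h3 := Real.rpow_add_le_add_rpow (p := α) (a := (x - y)/2) (b := (x-y)/2) (by linarith) (by linarith) hα0.le hα.2.le
    rw [add_halves] at h3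
    linarith
  rcases le_total 0 b with hb | hb
  · rw [Gpow_nonneg hα0 hb, Gpow_nonneg hα0 (hb.trans hab)]
    exact sub _ _ hb hab
  · have hb' : Gpow α b = - (-b) ^ α := by
      rw [← Gpow_nonneg hα0 (by linarith : 0 ≤ -b), Gpow_neg, neg_neg]
    rcases le_total 0 a with ha | ha
    · rw [Gpow_nonneg hα0 ha, hb', sub_neg_eq_add, abs_of_nonneg (by
        have : 0 ≤ -b := by linarith
        positivity)]
      have := (Real.concaveOn_rpow hα0.le hα.2.le).2 ha (show (0:ℝ) ≤ -b by linarith)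
        (show (0:ℝ) ≤ 1/2 by norm_num) (show (0:ℝ) ≤ 1/2 by norm_num) (by norm_num)
      simp only [smul_eq_mul] at this
      rw [show 1/2 * a + 1/2 * -b = (a - b)/2 by ring] at this
      linarith
    · have ha' : Gpow α a = - (-a) ^ α := by
        rw [← Gpow_nonneg hα0 (by linarith : 0 ≤ -a), Gpow_neg, neg_neg]
      rw [ha', hb']
      have := sub (-b) (-a) (by linarith) (by linarith)
      convert this using 2
      · ring
      · congr 1; ring

lemma Gpow_lip {α : ℝ} (hα : α ∈ Set.Ioo (0:ℝ) 1) (a b : ℝ) :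
    |Gpow α a - Gpow α b| ≤ 2 * (|a - b| / 2) ^ α := by
  rcases le_total b a with h | h
  · rw [abs_of_nonneg (sub_nonneg.2 h)]; exact Gpow_lip_le hα h
  · rw [abs_sub_comm, abs_sub_comm a, abs_of_nonneg (sub_nonneg.2 h)]; exact Gpow_lip_le hα h

/-- triangle wave -/
def Tri (y : ℝ) : ℝ := π / 2 - ‖(y : AddCircle (2 * π))‖

lemma Tri_lip (a b : ℝ) : |Tri a - Tri b| ≤ |a - b| := by
  unfold Tri
  rw [show π / 2 - ‖(a : AddCircle (2 * π))‖ - (π / 2 - ‖(b : AddCircle (2 * π))‖)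
    = ‖(b : AddCircle (2 * π))‖ - ‖(a : AddCircle (2 * π))‖ by ring]
  refine (abs_norm_sub_norm_le _ _).trans ?_
  rw [← AddCircle.coe_sub, abs_sub_comm a b]
  simpa using QuotientAddGroup.norm_mk_le_norm (S := AddSubgroup.zmultiples (2 * π)) (m := b - a)

lemma Tri_cont : Continuous Tri := by
  have : LipschitzWith 1 Tri := LipschitzWith.of_dist_le_mul fun s t => by
    rw [Real.dist_eq, Real.dist_eq]; simpa using Tri_lip s t
  exact this.continuous

lemma Tri_abs (y : ℝ) : |Tri y| ≤ π / 2 := by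
  have h1 := AddCircle.norm_le_half_period (2 * π) (x := (y : AddCircle (2 * π))) (by positivity)
  rw [abs_of_pos (by positivity)] at h1
  have h2 := norm_nonneg (y : AddCircle (2 * π))
  unfold Tri
  rw [abs_le]; constructor <;> linarith

lemma Tri_per (y : ℝ) : Tri (y + 2 * π) = Tri y := by
  unfold Tri; simp

lemma Tri_neg (y : ℝ) : Tri (-y) = Tri y := by
  unfold Tri; simp

lemma Tri_eq {y : ℝ} (h : |y| ≤ π) : Tri y = π / 2 - |y| := by
  unfold Tri
  rw [(AddCircle.norm_coe_eq_abs_iff (2 * π) (by positivity)).2]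
  rw [abs_of_pos (by positivity : 0 < 2 * π)]; linarith

lemma sin_Tri (y : ℝ) : Real.sin (Tri y) = Real.cos y := by
  unfold Tri
  rw [Real.sin_pi_div_two_sub, AddCircle.norm_eq, Real.cos_abs, Real.cos_sub_int_mul_two_pi]

/-- The profile. -/
def hprof (m : ℕ) (α y : ℝ) : ℝ := (2 * |Tri y| / m) ^ α * |Real.sin (Tri y)|

lemma hprof_cont {m : ℕ} {α : ℝ} (hα : 0 < α) : Continuous (hprof m α) := by
  have := Tri_cont
  unfold hprof
  exact (Continuous.rpow_const (by fun_prop) fun _ => Or.inr hα.le).mul (by fun_prop)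

lemma hprof_per (m : ℕ) (α y : ℝ) : hprof m α (y + 2 * π) = hprof m α y := by
  unfold hprof; rw [Tri_per]

lemma hprof_bounds {m : ℕ} (hm : 1 ≤ m) {α : ℝ} (hα : α ∈ Set.Ioo (0:ℝ) 1) (y : ℝ) :
    0 ≤ hprof m α y ∧ hprof m α y ≤ π := by
  have hm0 : (1:ℝ) ≤ m := by exact_mod_cast hm
  have hT := Tri_abs y
  refine ⟨by unfold hprof; positivity, ?_⟩
  unfold hprof
  have h1 : 2 * |Tri y| / m ≤ π := by
    rw [div_le_iff₀ (by linarith)]; nlinarith [Real.pi_pos]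
  have h2 : (2 * |Tri y| / m) ^ α ≤ π := by
    calc (2 * |Tri y| / m) ^ α ≤ π ^ α := Real.rpow_le_rpow (by positivity) h1 hα.1.le
      _ ≤ π ^ (1:ℝ) := Real.rpow_le_rpow_of_exponent_le (by linarith [Real.pi_gt_three]) hα.2.le
      _ = π := by simp
  calc _ ≤ π * 1 := mul_le_mul h2 (Real.abs_sin_le_one _) (abs_nonneg _) Real.pi_pos.le
    _ = π := mul_one _

lemma hprof_int {m : ℕ} {α : ℝ} (hα : α ∈ Set.Ioo (0:ℝ) 1) :
    ∫ y in (0:ℝ)..(2 * π), hprof m α y = 4 * eInt m (fun t => t ^ α) := by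
  have hc := hprof_cont (m := m) hα.1
  have hi := fun a b => hc.intervalIntegrable (μ := volume) a b
  rw [← integral_add_adjacent_intervals (hi 0 π) (hi π (2*π))]
  have e2 : ∫ y in π..(2*π), hprof m α y = ∫ y in (0:ℝ)..π, hprof m α y := by
    have := intervalIntegral.integral_comp_sub_left (a := 0) (b := π) (hprof m α) (2 * π)
    rw [show 2 * π - π = π by ring, sub_zero] at this
    rw [← this]
    congr 1; ext y
    rw [show 2 * π - y = -y + 2 * π by ring, hprof_per]
    unfold hprof; rw [Tri_neg]
  rw [e2, ← integral_add_adjacent_intervals (hi 0 (π/2)) (hi (π/2) π)]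
  have h1 : ∫ y in (0:ℝ)..(π/2), hprof m α y = eInt m (fun t => t ^ α) := by
    have := intervalIntegral.integral_comp_sub_left (a := 0) (b := π/2) (hprof m α) (π/2)
    rw [sub_self, sub_zero] at this
    rw [← this]
    unfold eInt
    apply intervalIntegral.integral_congr
    intro u hu
    rw [Set.uIcc_of_le (by positivity)] at hu
    have hT : Tri (π/2 - u) = u := by
      rw [Tri_eq, abs_of_nonneg] <;> [ring; linarith [hu.2]; skip]
      rw [abs_of_nonneg] <;> linarith [hu.1, hu.2, Real.pi_pos]
    simp only [hprof, hT]
    rw [abs_of_nonneg hu.1, abs_of_nonneg (Real.sin_nonneg_of_nonneg_of_le_pi hu.1 (by linarith [hu.2, Real.pi_pos]))]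
  have h2 : ∫ y in (π/2)..π, hprof m α y = eInt m (fun t => t ^ α) := by
    have := intervalIntegral.integral_comp_add_left (a := 0) (b := π/2) (hprof m α) (π/2)
    rw [add_zero, add_halves] at this
    rw [← this]
    unfold eInt
    apply intervalIntegral.integral_congr
    intro u hu
    rw [Set.uIcc_of_le (by positivity)] at hu
    have hT : Tri (π/2 + u) = -u := by
      rw [Tri_eq, abs_of_nonneg] <;> [ring; linarith [hu.1, Real.pi_pos]; skip]
      rw [abs_of_nonneg] <;> linarith [hu.1, hu.2, Real.pi_pos]
    simp only [hprof, hT]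
    rw [abs_neg, Real.sin_neg, abs_neg, abs_of_nonneg hu.1, abs_of_nonneg (Real.sin_nonneg_of_nonneg_of_le_pi hu.1 (by linarith [hu.2, Real.pi_pos]))]
  rw [h1, h2]; ring

namespace PhaseData

variable {m : ℕ} {A B L : ℝ} {R Y Y' : ℝ → ℝ}

lemma lower_step (h : PhaseData m A B L R Y Y') {α : ℝ} (hα : α ∈ Set.Ioo (0:ℝ) 1)
    {a b : ℝ} (hab : a ≤ b)
    (hb : b - a ≤ 4 * π / m) (hb' : |b - a - 2 * π / m| ≤ L * (4 * π) / m ^ 2) {k : ℕ}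
    (ha : Y a = 2 * π * k) (hYb : Y b = 2 * π * (k + 1 : ℕ)) :
    2 * eInt m (fun t => t ^ α) / π * (∫ x in a..b, R x) -
        (π * (4 * π + 1) * (4 * π) + 4 * ((4 * π) ^ 2 + 4 * π)) * B / m ^ 2 ≤
      ∫ x in a..b, R x * hprof m α (Y x) := by
  have hm := h.mpos
  have hB := h.B0
  have hRc := h.Rcont
  have hYc := h.Ycont
  have hY'c := h.Yc
  have hhc := hprof_cont (m := m) hα.1
  have hAL : ∀ x, R x * L ≤ B := fun x => (mul_le_mul_of_nonneg_right (h.RA x) h.hL0).trans h.hAL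
  have ALB : ∀ x, R x * (L * (4 * π) / m ^ 2) ≤ B * (4 * π) / m ^ 2 := by
    intro x
    rw [mul_div_assoc', div_le_div_iff_of_pos_right (by positivity), ← mul_assoc]
    exact mul_le_mul_of_nonneg_right (hAL x) (by positivity)
  have hsub : ∫ x in a..b, hprof m α (Y x) * Y' x = 4 * eInt m (fun t => t ^ α) := by
    have := intervalIntegral.integral_comp_mul_deriv (a := a) (b := b) (f := Y) (f' := Y')
      (g := hprof m α) (fun x _ => h.Yd x) hY'c.continuousOn hhc
    simp only [Function.comp] at this
    rw [this, ha, hYb, ← hprof_int hα]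
    have := (show Function.Periodic (hprof m α) (2 * π) from hprof_per m α).intervalIntegral_add_eq (2 * π * k) 0
    rw [zero_add] at this
    rw [← this]
    congr 1; push_cast; ring
  have s1 : |(∫ x in a..b, R x * hprof m α (Y x)) -
      ∫ x in a..b, (R a / m) * (hprof m α (Y x) * Y' x)| ≤ π * (4 * π + 1) * (4 * π) * B / m ^ 2 := by
    rw [← intervalIntegral.integral_sub (Continuous.intervalIntegrable (by fun_prop) _ _)
      (Continuous.intervalIntegrable (by fun_prop) _ _)]
    have := intervalIntegral.norm_integral_le_of_norm_le_const (a := a) (b := b)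
      (C := π * (B * (4 * π / m) + B / m))
      (f := fun x => R x * hprof m α (Y x) - (R a / m) * (hprof m α (Y x) * Y' x)) (fun x hx => by
        rw [Set.uIoc_of_le hab] at hx
        obtain ⟨p0, p1⟩ := hprof_bounds h.hm hα (Y x)
        rw [Real.norm_eq_abs, show R x * hprof m α (Y x) - (R a / m) * (hprof m α (Y x) * Y' x)
          = hprof m α (Y x) * ((R x - R a) + R a * (m - Y' x) / m) by field_simp; ring,
          abs_mul, abs_of_nonneg p0]
        apply mul_le_mul p1 _ (abs_nonneg _) Real.pi_pos.le
        have hx' : |x - a| ≤ 4 * π / m := by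
          rw [abs_of_nonneg (by linarith [hx.1])]; linarith [hx.2]
        refine (abs_add_le _ _).trans (add_le_add ?_ ?_)
        · exact (h.Rlip x a).trans (mul_le_mul_of_nonneg_left hx' hB)
        · rw [abs_div, abs_of_pos hm, div_le_div_iff_of_pos_right hm, abs_mul, abs_of_nonneg (h.R0 a),
            abs_sub_comm]
          exact (mul_le_mul_of_nonneg_left (h.YL x) (h.R0 a)).trans (hAL a))
    rw [Real.norm_eq_abs] at this
    refine this.trans ?_
    rw [abs_of_nonneg (by linarith)]
    calc π * (B * (4 * π / m) + B / m) * (b - a) ≤ π * (B * (4 * π / m) + B / m) * (4 * π / m) :=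
          mul_le_mul_of_nonneg_left hb (by positivity)
      _ = _ := by field_simp
  rw [intervalIntegral.integral_const_mul, hsub] at s1
  obtain ⟨he0, he6⟩ := eInt_bounds hα h.hm
  set e := eInt m (fun t => t ^ α) with hedef
  have s4 : (∫ x in a..b, R x) - (B * (4 * π) ^ 2 + B * (4 * π)) / m ^ 2 ≤ R a * (2 * π / m) := by
    have r1 := (abs_le.1 (h.Rint_step hab hb)).1
    have r2 := mul_le_mul_of_nonneg_left (le_of_abs_le hb') (h.R0 a)
    have r3 := ALB a
    have r4 : B * (4 * π / m) ^ 2 = B * (4 * π) ^ 2 / m ^ 2 := by rw [div_pow]; ring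
    rw [add_div]
    nlinarith
  have hpi := Real.pi_gt_three
  have hep : 2 * e / π ≤ 4 := by rw [div_le_iff₀ (by positivity)]; linarith
  have s5 : 2 * e / π * (∫ x in a..b, R x) - 4 * ((4 * π) ^ 2 + 4 * π) * B / m ^ 2 ≤ R a / m * (4 * e) := by
    have : R a / m * (4 * e) = 2 * e / π * (R a * (2 * π / m)) := by field_simp; ring
    rw [this]
    have h1 := mul_le_mul_of_nonneg_left s4 (by positivity : 0 ≤ 2 * e / π)
    have h2 := mul_le_mul_of_nonneg_right hep (by positivity : 0 ≤ (B * (4 * π) ^ 2 + B * (4 * π)) / (m:ℝ) ^ 2)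
    have h3 : 4 * ((4 * π) ^ 2 + 4 * π) * B / (m:ℝ) ^ 2 = 4 * ((B * (4 * π) ^ 2 + B * (4 * π)) / (m:ℝ) ^ 2) := by ring
    rw [h3]
    linarith
  have e1 := (abs_le.1 s1).1
  rw [add_mul, add_div]
  linarith

/-- Lower estimate. -/
lemma lower (h : PhaseData m A B L R Y Y') {α : ℝ} (hα : α ∈ Set.Ioo (0:ℝ) 1) :
    ∃ φ ∈ Hclass (fun t => t ^ α),
      eInt m (fun t => t ^ α) / π * (∫ x in (0:ℝ)..(2 * π), R x) -
        ((π * (4 * π + 1) * (4 * π) + 4 * ((4 * π) ^ 2 + 4 * π)) / 2 + 4 * π) * B / m ≤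
      ∫ x in (0:ℝ)..(2 * π), φ x * (R x * Real.cos (Y x)) := by
  have hm := h.mpos
  have hRc := h.Rcont
  have hYc := h.Ycont
  have hTc := Tri_cont
  have hGc := Gpow_cont hα.1
  have hhc := hprof_cont (m := m) hα.1
  have hL0 := h.hL0
  have hB := h.B0
  have hYp : ∀ x, Tri (Y (x + 2 * π)) = Tri (Y x) := fun x => by
    rw [h.Yper, show 2 * π * (m:ℝ) = m * (2 * π) by ring]
    exact (show Function.Periodic Tri (2 * π) from Tri_per).nat_mul m (Y x)
  set c : ℝ := 1 + L / m with hc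
  have hc1 : 1 ≤ c := by rw [hc]; have : 0 ≤ L / m := by positivity
                         linarith
  set φ : ℝ → ℝ := fun t => c⁻¹ * (1 / 2 * Gpow α (2 * Tri (Y t) / m)) with hφ
  have hmem : φ ∈ Hclass (fun t => t ^ α) := by
    refine ⟨by fun_prop, fun x => by simp only [hφ, hYp], fun s t => ?_⟩
    simp only [hφ]
    rw [← mul_sub, ← mul_sub, abs_mul, abs_mul, abs_of_pos (by positivity : 0 < c⁻¹)]
    have h1 := Gpow_lip hα (2 * Tri (Y s) / m) (2 * Tri (Y t) / m)
    have h2 : |2 * Tri (Y s) / m - 2 * Tri (Y t) / m| / 2 ≤ c * |s - t| := by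
      have l1 := Tri_lip (Y s) (Y t)
      have l2 := h.Ylip s t
      have l3 : |Y s - Y t| ≤ (L + m) * |s - t| := by
        have := abs_add_le (Y s - Y t - m * (s - t)) (m * (s - t))
        rw [sub_add_cancel, abs_mul (m:ℝ), abs_of_pos hm] at this
        linarith
      rw [show 2 * Tri (Y s) / m - 2 * Tri (Y t) / m = 2 * (Tri (Y s) - Tri (Y t)) / m by ring,
        abs_div, abs_mul, abs_two, abs_of_pos hm, div_div, div_le_iff₀ (by positivity)]
      have : c * |s - t| * (m * 2) = 2 * ((L + m) * |s - t|) := by rw [hc]; field_simp; ring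
      rw [this]; linarith
    have h3 : (|2 * Tri (Y s) / m - 2 * Tri (Y t) / m| / 2) ^ α ≤ c * |s - t| ^ α := by
      calc _ ≤ (c * |s - t|) ^ α := Real.rpow_le_rpow (by positivity) h2 hα.1.le
        _ = c ^ α * |s - t| ^ α := Real.mul_rpow (by positivity) (abs_nonneg _)
        _ ≤ c ^ (1:ℝ) * |s - t| ^ α := by
            gcongr
            exact hα.2.le
        _ = _ := by rw [Real.rpow_one]
    rw [inv_mul_le_iff₀ (by positivity), abs_of_pos (by norm_num : (0:ℝ) < 1/2)]
    linarith
  refine ⟨φ, hmem, ?_⟩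
  have hpt : ∀ x, φ x * (R x * Real.cos (Y x)) = c⁻¹ * (1 / 2) * (R x * hprof m α (Y x)) := by
    intro x
    have : Gpow α (2 * Tri (Y x) / m) * Real.cos (Y x) = hprof m α (Y x) := by
      rw [← sin_Tri]
      unfold hprof
      have hT := abs_le.1 (Tri_abs (Y x))
      rcases le_total 0 (Tri (Y x)) with h0 | h0
      · rw [Gpow_nonneg hα.1 (by positivity), abs_of_nonneg h0, abs_of_nonneg]
        exact Real.sin_nonneg_of_nonneg_of_le_pi h0 (by linarith [Real.pi_pos])
      · have h1 : 0 ≤ -Tri (Y x) := by linarith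
        rw [abs_of_nonpos h0, abs_of_nonpos (Real.sin_nonpos_of_nonpos_of_neg_pi_le h0 (by linarith [Real.pi_pos])),
          ← Gpow_nonneg hα.1 (by positivity),
          show 2 * -Tri (Y x) / m = -(2 * Tri (Y x) / m) by ring, Gpow_neg]
        ring
    simp only [hφ]
    rw [← this]; ring
  simp only [hpt]
  rw [intervalIntegral.integral_const_mul]
  obtain ⟨t, ht, hmono, htm, hst, hst'⟩ := h.partition
  have main : 2 * eInt m (fun t => t ^ α) / π * (∫ x in (0:ℝ)..(2 * π), R x) -
        (π * (4 * π + 1) * (4 * π) + 4 * ((4 * π) ^ 2 + 4 * π)) * B / m ≤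
      ∫ x in (0:ℝ)..(2 * π), R x * hprof m α (Y x) := by
    rw [← sum_partition (m := m) (F := fun x => R x * hprof m α (Y x)) (by fun_prop) (fun x => by
      unfold hprof; rw [h.Rper, hYp]) t htm, ← sum_partition (m := m) hRc h.Rper t htm]
    refine le_trans (le_of_eq ?_) (Finset.sum_le_sum fun k _ =>
      h.lower_step hα (hmono k) (hst k) (hst' k) (ht k) (ht (k+1)))
    rw [Finset.sum_sub_distrib, ← Finset.mul_sum, Finset.sum_const, Finset.card_range, nsmul_eq_mul]
    congr 1
    field_simp
  obtain ⟨he0, he6⟩ := eInt_bounds hα h.hm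
  set e := eInt m (fun t => t ^ α) with hedef
  set I := ∫ x in (0:ℝ)..(2 * π), R x with hI
  have hI0 : 0 ≤ I := intervalIntegral.integral_nonneg (by positivity) fun x _ => h.R0 x
  have hIA : I ≤ 2 * π * A := by
    have : I ≤ ∫ x in (0:ℝ)..(2 * π), A := intervalIntegral.integral_mono_on (by positivity)
      (hRc.intervalIntegrable _ _) intervalIntegrable_const fun x _ => h.RA x
    simpa using this
  set D := (π * (4 * π + 1) * (4 * π) + 4 * ((4 * π) ^ 2 + 4 * π)) with hD
  have hD0 : 0 ≤ D := by positivity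
  have hpi := Real.pi_gt_three
  have hep : e / π ≤ 2 := by rw [div_le_iff₀ (by positivity)]; linarith
  have hci : c⁻¹ ≤ 1 := inv_le_one_of_one_le₀ hc1
  have hci0 : 0 ≤ c⁻¹ := by positivity
  have hcl : 1 - L / m ≤ c⁻¹ := by
    rw [le_inv_comm₀ (by
      have := h.hLm
      have : L / m ≤ 1 / 2 := by rw [div_le_iff₀ hm]; linarith
      linarith) (by positivity), ← one_div, le_div_iff₀ (by
      have := h.hLm
      have : L / m ≤ 1 / 2 := by rw [div_le_iff₀ hm]; linarith
      linarith), hc]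
    nlinarith [sq_nonneg (L / m)]
  have k1 := mul_le_mul_of_nonneg_left main (by positivity : 0 ≤ c⁻¹ * (1/2))
  refine le_trans ?_ k1
  have k2 : e / π * I * (L / m) ≤ 4 * π * B / m := by
    calc e / π * I * (L / m) ≤ 2 * (2 * π * A) * (L / m) := by gcongr
      _ = 4 * π * (A * L) / m := by ring
      _ ≤ 4 * π * B / m := by gcongr; exact h.hAL
  have k3 : c⁻¹ * (D / 2 * B / m) ≤ D / 2 * B / m := by
    have : 0 ≤ D / 2 * B / m := by positivity
    nlinarith
  have k4 : e / π * I * (1 - L / m) ≤ e / π * I * c⁻¹ :=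
    mul_le_mul_of_nonneg_left hcl (by positivity)
  have k5 : c⁻¹ * (1 / 2) * (2 * e / π * I - D * B / m) = e / π * I * c⁻¹ - c⁻¹ * (D / 2 * B / m) := by ring
  rw [k5, add_mul, add_div]
  linarith

end PhaseData

/-- `1 - r e^{iu}`. -/
def wf (r u : ℝ) : ℂ := 1 - r * Complex.exp (u * Complex.I)

/-- the argument of `1 - r e^{iu}`. -/
def thf (r u : ℝ) : ℝ := (Complex.log (wf r u)).im

/-- the derivative of `thf`. -/
def thf' (r u : ℝ) : ℝ := ((-(r * (Complex.exp (u * Complex.I) * Complex.I))) / wf r u).im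

lemma wf_norm_ge {r : ℝ} (hr : 0 ≤ r) (u : ℝ) : 1 - r ≤ ‖wf r u‖ := by
  have h := norm_sub_norm_le (1:ℂ) (r * Complex.exp (u * Complex.I))
  rw [norm_one, norm_mul, Complex.norm_exp_ofReal_mul_I, mul_one, Complex.norm_real, Real.norm_eq_abs,
    abs_of_nonneg hr] at h
  exact h

lemma wf_ne {r : ℝ} (hr : 0 ≤ r) (hr1 : r < 1) (u : ℝ) : wf r u ≠ 0 := by
  have := wf_norm_ge hr u
  intro h
  rw [h, norm_zero] at this
  linarith

lemma wf_re (r u : ℝ) : (wf r u).re = 1 - r * Real.cos u := by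
  simp [wf, Complex.exp_ofReal_mul_I_re]

lemma wf_im (r u : ℝ) : (wf r u).im = - (r * Real.sin u) := by
  simp [wf, Complex.exp_ofReal_mul_I_im]

lemma wf_slit {r : ℝ} (hr : 0 ≤ r) (hr1 : r < 1) (u : ℝ) : wf r u ∈ Complex.slitPlane := by
  left
  rw [wf_re]
  nlinarith [Real.cos_le_one u]

lemma wf_deriv (r u : ℝ) :
    HasDerivAt (wf r) (-(r * (Complex.exp (u * Complex.I) * Complex.I))) u := by
  have h1 : HasDerivAt (fun u : ℝ => (u:ℂ) * Complex.I) (1 * Complex.I) u :=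
    (Complex.ofRealCLM.hasDerivAt (x := u)).mul_const Complex.I
  have h2 := (h1.cexp.const_mul (r:ℂ)).const_sub 1
  rw [one_mul] at h2
  exact h2

lemma wf_cont (r : ℝ) : Continuous (wf r) :=
  continuous_iff_continuousAt.2 fun u => (wf_deriv r u).continuousAt

lemma thf_deriv {r : ℝ} (hr : 0 ≤ r) (hr1 : r < 1) (u : ℝ) : HasDerivAt (thf r) (thf' r u) u := by
  have := (wf_deriv r u).clog_real (wf_slit hr hr1 u)
  exact Complex.imCLM.hasFDerivAt.comp_hasDerivAt u this

lemma thf'_cont {r : ℝ} (hr : 0 ≤ r) (hr1 : r < 1) : Continuous (thf' r) := by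
  unfold thf'
  have := wf_cont r
  exact Complex.continuous_im.comp (Continuous.div (by fun_prop) this fun u => wf_ne hr hr1 u)

lemma thf'_le {r : ℝ} (hr : 0 ≤ r) (hr1 : r < 1) (u : ℝ) : |thf' r u| ≤ r / (1 - r) := by
  refine (Complex.abs_im_le_norm _).trans ?_
  rw [norm_div, norm_neg, norm_mul, norm_mul, Complex.norm_exp_ofReal_mul_I, Complex.norm_I, mul_one, mul_one,
    Complex.norm_real, Real.norm_eq_abs, abs_of_nonneg hr]
  exact div_le_div_of_nonneg_left hr (by linarith) (wf_norm_ge hr u)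

lemma wf_polar (r u : ℝ) : wf r u = ‖wf r u‖ * Complex.exp (thf r u * Complex.I) := by
  unfold thf
  rw [Complex.log_im, Complex.norm_mul_exp_arg_mul_I]

lemma wf_norm (r u : ℝ) : ‖wf r u‖ = Real.sqrt (1 - 2 * r * Real.cos u + r ^ 2) := by
  rw [Complex.norm_def, Complex.normSq_apply, wf_re, wf_im]
  congr 1
  nlinarith [Real.sin_sq_add_cos_sq u]

lemma wf_per (r u : ℝ) (p : ℕ) : wf r (u + p * (2 * π)) = wf r u := by
  unfold wf
  congr 2
  push_cast
  rw [add_mul, show (p:ℂ) * (2 * π) * Complex.I = p * (2 * π * Complex.I) by ring,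
    Complex.exp_add, Complex.exp_nat_mul_two_pi_mul_I, mul_one]

/-- The amplitude. -/
def Rk (q : ℝ) (p : ℕ) (t : ℝ) : ℝ := ‖wf (q ^ p) (p * t)‖ / ‖wf q t‖ ^ 2

/-- The phase. -/
def Yk (q γ : ℝ) (m p : ℕ) (t : ℝ) : ℝ := m * t + γ + thf (q ^ p) (p * t) - 2 * thf q t

/-- The derivative of the phase. -/
def Yk' (q : ℝ) (m p : ℕ) (t : ℝ) : ℝ := m + thf' (q ^ p) (p * t) * p - 2 * thf' q t

lemma Rk_int (q : ℝ) (p : ℕ) : ∫ t in (0:ℝ)..(2*π), Rk q p t = Kpq p q := by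
  unfold Kpq
  congr 1
  ext t
  unfold Rk
  rw [wf_norm, wf_norm, Real.sq_sqrt, ← pow_mul, mul_comm p 2]
  nlinarith [Real.sin_sq_add_cos_sq t, sq_nonneg (q - Real.cos t), sq_nonneg (Real.sin t)]

lemma Zpow (q t : ℝ) (j : ℕ) : ((q:ℂ) * Complex.exp (t * Complex.I)) ^ j =
    ((q ^ j : ℝ) : ℂ) * Complex.exp (((j * t : ℝ) : ℂ) * Complex.I) := by
  rw [mul_pow, ← Complex.exp_nat_mul]
  push_cast
  congr 2; ring

lemma kernel_polar {q : ℝ} (hq0 : 0 < q) (hq1 : q < 1) (γ : ℝ) (m p : ℕ) (t : ℝ) :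
    (Complex.exp (γ * Complex.I) * ((q:ℂ) * Complex.exp (t * Complex.I)) ^ m *
      (1 - ((q:ℂ) * Complex.exp (t * Complex.I)) ^ p) / (1 - (q:ℂ) * Complex.exp (t * Complex.I)) ^ 2).re
      = q ^ m * (Rk q p t * Real.cos (Yk q γ m p t)) := by
  have hw : (1 - (q:ℂ) * Complex.exp (t * Complex.I)) = wf q t := rfl
  have hwp : (1 - ((q:ℂ) * Complex.exp (t * Complex.I)) ^ p) = wf (q ^ p) (p * t) := by
    rw [Zpow]; rfl
  rw [hw, hwp, Zpow]
  have hne : (‖wf q t‖ : ℂ) ≠ 0 := by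
    exact_mod_cast (norm_ne_zero_iff.2 (wf_ne hq0.le hq1 t))
  have key : Complex.exp (γ * Complex.I) * (((q ^ m : ℝ) : ℂ) * Complex.exp (((m * t : ℝ) : ℂ) * Complex.I)) *
      wf (q ^ p) (p * t) / wf q t ^ 2 =
      ((q ^ m * Rk q p t : ℝ) : ℂ) * Complex.exp ((Yk q γ m p t : ℝ) * Complex.I) := by
    have e : Complex.exp ((Yk q γ m p t : ℝ) * Complex.I) =
      Complex.exp (γ * Complex.I) * Complex.exp (((m * t : ℝ) : ℂ) * Complex.I) *
        Complex.exp (thf (q ^ p) (p * t) * Complex.I) / Complex.exp (thf q t * Complex.I) ^ 2 := by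
      rw [← Complex.exp_nat_mul, ← Complex.exp_add, ← Complex.exp_add, ← Complex.exp_sub]
      congr 1
      unfold Yk
      push_cast; ring
    rw [e]
    conv_lhs => rw [wf_polar q t, wf_polar (q ^ p) (p * t)]
    unfold Rk
    push_cast
    have := Complex.exp_ne_zero (thf q t * Complex.I)
    field_simp
  rw [key, Complex.re_ofReal_mul, Complex.exp_ofReal_mul_I_re, mul_assoc]

/-- The geometric sum. -/
def Sg (q : ℝ) (p : ℕ) (t : ℝ) : ℂ := ∑ j ∈ Finset.range p, ((q:ℂ) * Complex.exp (t * Complex.I)) ^ j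

lemma Rk_eq {q : ℝ} (hq0 : 0 < q) (hq1 : q < 1) (p : ℕ) (t : ℝ) : Rk q p t = ‖Sg q p t / wf q t‖ := by
  have hwp : (1 - ((q:ℂ) * Complex.exp (t * Complex.I)) ^ p) = wf (q ^ p) (p * t) := by
    rw [Zpow]; rfl
  have h := mul_neg_geom_sum ((q:ℂ) * Complex.exp (t * Complex.I)) p
  have h' : wf q t * Sg q p t = wf (q ^ p) (p * t) := by rw [← hwp]; exact h
  have hne := norm_ne_zero_iff.2 (wf_ne hq0.le hq1 t)
  unfold Rk
  rw [← h', norm_mul, norm_div]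
  field_simp

lemma exp_lip (s t : ℝ) : ‖Complex.exp (s * Complex.I) - Complex.exp (t * Complex.I)‖ ≤ |s - t| := by
  have h : Complex.exp (s * Complex.I) - Complex.exp (t * Complex.I) =
      Complex.exp (t * Complex.I) * (Complex.exp (Complex.I * ((s - t : ℝ) : ℂ)) - 1) := by
    rw [mul_sub, ← Complex.exp_add, mul_one]
    congr 2; push_cast; ring
  rw [h, norm_mul, Complex.norm_exp_ofReal_mul_I, one_mul]
  exact Real.norm_exp_I_mul_ofReal_sub_one_le

lemma Zpow_lip {q : ℝ} (hq0 : 0 < q) (j : ℕ) (s t : ℝ) :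
    ‖((q:ℂ) * Complex.exp (s * Complex.I)) ^ j - ((q:ℂ) * Complex.exp (t * Complex.I)) ^ j‖ ≤ j * q ^ j * |s - t| := by
  rw [Zpow, Zpow, ← mul_sub, norm_mul, Complex.norm_real, Real.norm_eq_abs, abs_of_pos (by positivity)]
  have := exp_lip (j * s) (j * t)
  rw [← mul_sub, abs_mul, abs_of_nonneg (Nat.cast_nonneg j)] at this
  calc _ ≤ q ^ j * (j * |s - t|) := by gcongr
    _ = _ := by ring

lemma Sg_lip {q : ℝ} (hq0 : 0 < q) (hq1 : q < 1) (p : ℕ) (s t : ℝ) :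
    ‖Sg q p s - Sg q p t‖ ≤ 1 / (1 - q) ^ 2 * |s - t| := by
  unfold Sg
  rw [← Finset.sum_sub_distrib]
  refine (norm_sum_le _ _).trans ((Finset.sum_le_sum fun j _ => Zpow_lip hq0 j s t).trans ?_)
  rw [← Finset.sum_mul]
  apply mul_le_mul_of_nonneg_right _ (abs_nonneg _)
  have hs := hasSum_coe_mul_geometric_of_norm_lt_one (r := q) (by rw [Real.norm_eq_abs, abs_of_pos hq0]; exact hq1)
  refine (sum_le_hasSum _ (fun j _ => by positivity) hs).trans ?_
  have : 0 < 1 - q := by linarith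
  gcongr

lemma Sg_le {q : ℝ} (hq0 : 0 < q) (hq1 : q < 1) (p : ℕ) (t : ℝ) : ‖Sg q p t‖ ≤ 1 / (1 - q) := by
  unfold Sg
  refine (norm_sum_le _ _).trans ?_
  have hs := hasSum_geometric_of_lt_one hq0.le hq1
  rw [one_div]
  refine le_trans (le_of_eq ?_) (sum_le_hasSum (Finset.range p) (fun j _ => by positivity) hs)
  apply Finset.sum_congr rfl
  intro j _
  rw [Zpow, norm_mul, Complex.norm_real, Complex.norm_exp_ofReal_mul_I, mul_one, Real.norm_eq_abs,
    abs_of_pos (by positivity)]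

lemma inv_w_le {q : ℝ} (hq0 : 0 < q) (hq1 : q < 1) (t : ℝ) : ‖(wf q t)⁻¹‖ ≤ 1 / (1 - q) := by
  rw [norm_inv, ← one_div]
  exact one_div_le_one_div_of_le (by linarith) (wf_norm_ge hq0.le t)

lemma inv_w_lip {q : ℝ} (hq0 : 0 < q) (hq1 : q < 1) (s t : ℝ) :
    ‖(wf q s)⁻¹ - (wf q t)⁻¹‖ ≤ 1 / (1 - q) ^ 2 * |s - t| := by
  have hs := wf_ne hq0.le hq1 s
  have ht := wf_ne hq0.le hq1 t
  have h : (wf q s)⁻¹ - (wf q t)⁻¹ = (wf q s)⁻¹ * (wf q t)⁻¹ * (wf q t - wf q s) := by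
    field_simp
  have h2 : ‖wf q t - wf q s‖ ≤ |s - t| := by
    have := Zpow_lip hq0 1 s t
    simp only [pow_one, Nat.cast_one, one_mul] at this
    have h3 : wf q t - wf q s = (q:ℂ) * Complex.exp (s * Complex.I) - (q:ℂ) * Complex.exp (t * Complex.I) := by
      unfold wf; ring
    rw [h3]
    refine this.trans ?_
    nlinarith [abs_nonneg (s - t)]
  have hd : 0 < 1 - q := by linarith
  rw [h, norm_mul, norm_mul]
  calc _ ≤ 1 / (1 - q) * (1 / (1 - q)) * |s - t| := by
        gcongr
        · exact inv_w_le hq0 hq1 s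
        · exact inv_w_le hq0 hq1 t
    _ = _ := by field_simp

lemma pow_ratio {q : ℝ} (hq0 : 0 < q) (hq1 : q < 1) {p : ℕ} (hp : 1 ≤ p) :
    q ^ p / (1 - q ^ p) * p ≤ 1 / (1 - q) := by
  have hd : 0 < 1 - q := by linarith
  have h1 : q ^ p < 1 := pow_lt_one₀ hq0.le hq1 (by omega)
  have hg := mul_neg_geom_sum q p
  have hs : p * q ^ p ≤ ∑ j ∈ Finset.range p, q ^ j := by
    have : ∑ j ∈ Finset.range p, q ^ p ≤ ∑ j ∈ Finset.range p, q ^ j := by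
      apply Finset.sum_le_sum
      intro j hj
      exact pow_le_pow_of_le_one hq0.le hq1.le (Finset.mem_range.1 hj).le
    simpa using this
  rw [div_mul_eq_mul_div, div_le_div_iff₀ (by linarith) hd, ← hg]
  nlinarith

lemma phaseData {q : ℝ} (hq0 : 0 < q) (hq1 : q < 1) (γ : ℝ) {m p : ℕ} (hp : 1 ≤ p)
    (hm : 6 / (1 - q) ≤ m) :
    PhaseData m (1 / (1 - q) ^ (δp p - 1)) (3 / (1 - q) ^ δp p) (3 / (1 - q))
      (Rk q p) (Yk q γ m p) (Yk' q m p) := by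
  have hd : 0 < 1 - q := by linarith
  have hqp0 : 0 ≤ q ^ p := by positivity
  have hqp1 : q ^ p < 1 := pow_lt_one₀ hq0.le hq1 (by omega)
  have hm6 : (6:ℝ) ≤ m := by
    refine le_trans ?_ hm
    rw [le_div_iff₀ hd]; nlinarith
  have hper : ∀ t : ℝ, (p:ℝ) * (t + 2 * π) = p * t + p * (2 * π) := fun t => by ring
  have hper1 : ∀ t : ℝ, wf q (t + 2 * π) = wf q t := fun t => by
    have := wf_per q t 1
    simpa using this
  have hδ : (p = 1 ∧ δp p = 2) ∨ δp p = 3 := by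
    unfold δp
    split_ifs with h
    · exact Or.inl ⟨h, rfl⟩
    · exact Or.inr rfl
  refine ⟨by have : (1:ℝ) ≤ m := by linarith
             exact_mod_cast this, by positivity, ?_, ?_, ?_, ?_, ?_, ?_, ?_, ?_, ?_, ?_⟩
  · have : 3 / (1 - q) = 6 / (1 - q) / 2 := by ring
    rw [this]; linarith
  · have : (1 - q) ^ δp p = (1 - q) ^ (δp p - 1) * (1 - q) := by
      rw [← pow_succ]; congr 1
      rcases hδ with h | h <;> omega
    rw [this]
    exact le_of_eq (by field_simp)
  · intro t; unfold Rk; positivity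
  · intro t
    rw [Rk_eq hq0 hq1]
    rcases hδ with ⟨h1, h2⟩ | h
    · subst h1
      have := inv_w_le hq0 hq1 t
      rw [h2]
      simpa [Sg] using this
    · rw [h, div_eq_mul_inv, norm_mul]
      calc _ ≤ 1 / (1 - q) * (1 / (1 - q)) := by
            gcongr
            · exact Sg_le hq0 hq1 p t
            · exact inv_w_le hq0 hq1 t
        _ = _ := by norm_num; field_simp
  · intro s t
    rw [Rk_eq hq0 hq1, Rk_eq hq0 hq1]
    refine (abs_norm_sub_norm_le _ _).trans ?_
    rcases hδ with ⟨h1, h2⟩ | h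
    · subst h1
      have := inv_w_lip hq0 hq1 s t
      rw [h2]
      have e : Sg q 1 s / wf q s - Sg q 1 t / wf q t = (wf q s)⁻¹ - (wf q t)⁻¹ := by simp [Sg]
      rw [e]
      refine this.trans ?_
      gcongr
      norm_num
    · have e : Sg q p s / wf q s - Sg q p t / wf q t =
        (Sg q p s - Sg q p t) * (wf q s)⁻¹ + Sg q p t * ((wf q s)⁻¹ - (wf q t)⁻¹) := by
        rw [div_eq_mul_inv, div_eq_mul_inv]; ring
      rw [e, h]
      refine (norm_add_le _ _).trans ?_
      rw [norm_mul, norm_mul]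
      calc _ ≤ 1 / (1 - q) ^ 2 * |s - t| * (1 / (1 - q)) + 1 / (1 - q) * (1 / (1 - q) ^ 2 * |s - t|) := by
            gcongr
            · exact Sg_lip hq0 hq1 p s t
            · exact inv_w_le hq0 hq1 s
            · exact Sg_le hq0 hq1 p t
            · exact inv_w_lip hq0 hq1 s t
        _ = 2 / (1 - q) ^ 3 * |s - t| := by field_simp; ring
        _ ≤ _ := by gcongr; norm_num
  · intro t
    unfold Rk
    rw [hper, wf_per, hper1]
  · intro t
    have h1 : HasDerivAt (fun t : ℝ => thf (q ^ p) (p * t)) (thf' (q ^ p) (p * t) * p) t := by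
      have := (thf_deriv hqp0 hqp1 (p * t)).comp t ((hasDerivAt_id t).const_mul (p:ℝ))
      simpa [Function.comp_def] using this
    have h2 := (thf_deriv hq0.le hq1 t).const_mul 2
    have h3 : HasDerivAt (fun t : ℝ => (m:ℝ) * t + γ) (m:ℝ) t := by
      simpa using ((hasDerivAt_id t).const_mul (m:ℝ)).add_const γ
    exact (h3.add h1).sub h2
  · unfold Yk'
    have h1 := thf'_cont hqp0 hqp1
    have h2 := thf'_cont hq0.le hq1
    fun_prop
  · intro t
    unfold Yk'
    have h1 := thf'_le hqp0 hqp1 (p * t)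
    have h2 := thf'_le hq0.le hq1 t
    have h3 := pow_ratio hq0 hq1 hp
    have h4 : q / (1 - q) ≤ 1 / (1 - q) := by gcongr
    have h5 : |thf' (q ^ p) (p * t) * p| ≤ q ^ p / (1 - q ^ p) * p := by
      rw [abs_mul, Nat.abs_cast]
      gcongr
    have h6 : (3:ℝ) / (1 - q) = 3 * (1 / (1 - q)) := by ring
    rw [h6]
    rw [abs_le] at *
    constructor <;> linarith [h5.1, h5.2, h2.1, h2.2]
  · intro t
    unfold Yk thf
    rw [hper, wf_per, hper1]
    ring

/-- term of the Poisson kernel -/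
def tmk (q γ : ℝ) (i : ℕ) (s : ℝ) : ℝ := q ^ (i + 1) * Real.cos ((i + 1 : ℕ) * s + γ)

lemma tmk_cont (q γ : ℝ) (i : ℕ) : Continuous (tmk q γ i) := by unfold tmk; fun_prop

lemma tmk_abs {q : ℝ} (hq0 : 0 < q) (γ : ℝ) (i : ℕ) (s : ℝ) : |tmk q γ i s| ≤ q ^ (i + 1) := by
  unfold tmk
  rw [abs_mul, abs_of_pos (by positivity)]
  calc _ ≤ q ^ (i+1) * 1 := by gcongr; exact Real.abs_cos_le_one _
    _ = _ := mul_one _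

lemma geo_summable {q : ℝ} (hq0 : 0 < q) (hq1 : q < 1) : Summable fun i : ℕ => q ^ (i + 1) :=
  (summable_nat_add_iff 1).2 (summable_geometric_of_lt_one hq0.le hq1)

lemma Pker_hasSum {q : ℝ} (hq0 : 0 < q) (hq1 : q < 1) (β s : ℝ) :
    HasSum (fun i => tmk q (β * π / 2) i s) (Pker q β s) :=
  (Summable.of_norm_bounded (geo_summable hq0 hq1) fun i => tmk_abs hq0 _ i s).hasSum

lemma Pker_cont {q : ℝ} (hq0 : 0 < q) (hq1 : q < 1) (β : ℝ) : Continuous (Pker q β) :=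
  continuous_tsum (fun i => tmk_cont q (β * π / 2) i) (geo_summable hq0 hq1)
    fun i s => tmk_abs hq0 _ i s

lemma tmk_re (q γ : ℝ) (i : ℕ) (s : ℝ) : tmk q γ i s =
    (Complex.exp (γ * Complex.I) * ((q:ℂ) * Complex.exp (s * Complex.I)) ^ (i + 1)).re := by
  rw [Zpow, mul_left_comm, ← Complex.exp_add, ← add_mul, ← Complex.ofReal_add, Complex.re_ofReal_mul,
    Complex.exp_ofReal_mul_I_re, add_comm γ]
  rfl

/-- tail kernel -/
def tailk (q β : ℝ) (k : ℕ) (s : ℝ) : ℝ := Pker q β s - ∑ i ∈ Finset.range k, tmk q (β * π / 2) i s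

lemma Zlt {q : ℝ} (hq0 : 0 < q) (hq1 : q < 1) (s : ℝ) : ‖(q:ℂ) * Complex.exp (s * Complex.I)‖ < 1 := by
  rw [norm_mul, Complex.norm_exp_ofReal_mul_I, mul_one, Complex.norm_real, Real.norm_eq_abs, abs_of_pos hq0]
  exact hq1

lemma tailk_re {q : ℝ} (hq0 : 0 < q) (hq1 : q < 1) (β : ℝ) (k : ℕ) (s : ℝ) :
    tailk q β k s = (Complex.exp ((β * π / 2 : ℝ) * Complex.I) *
      ((q:ℂ) * Complex.exp (s * Complex.I)) ^ (k + 1) / (1 - (q:ℂ) * Complex.exp (s * Complex.I))).re := by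
  have h1 : HasSum (fun i => tmk q (β * π / 2) (i + k) s) (tailk q β k s) := by
    have := (hasSum_nat_add_iff' k).2 (Pker_hasSum hq0 hq1 β s)
    exact this
  set Z := (q:ℂ) * Complex.exp (s * Complex.I) with hZ
  have h2 := (hasSum_geometric_of_norm_lt_one (Zlt hq0 hq1 s)).mul_left
    (Complex.exp ((β * π / 2 : ℝ) * Complex.I) * Z ^ (k + 1))
  rw [← div_eq_mul_inv] at h2
  have h3 := Complex.hasSum_re h2
  refine h1.unique ?_
  convert h3 using 1
  ext i
  rw [tmk_re, ← hZ, mul_assoc _ (Z ^ (k+1)), ← pow_add]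
  congr 3; ring

lemma swap {q : ℝ} (hq0 : 0 < q) (hq1 : q < 1) {F : ℕ → ℝ → ℝ} {f : ℝ → ℝ} {M : ℝ}
    (hF : ∀ i, Continuous (F i)) (hb : ∀ i u, |F i u| ≤ M * q ^ (i + 1))
    (hs : ∀ u, HasSum (fun i => F i u) (f u)) (a b : ℝ) :
    HasSum (fun i => ∫ u in a..b, F i u) (∫ u in a..b, f u) := by
  apply intervalIntegral.hasSum_integral_of_dominated_convergence (fun i _ => M * q ^ (i+1))
  · exact fun i => (hF i).aestronglyMeasurable
  · exact fun i => Filter.Eventually.of_forall fun u _ => hb i u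
  · exact Filter.Eventually.of_forall fun u _ => (geo_summable hq0 hq1).mul_left M
  · exact intervalIntegrable_const
  · exact Filter.Eventually.of_forall fun u _ => hs u

lemma int_cos_nat {k : ℕ} (hk : k ≠ 0) (c : ℝ) : ∫ x in (0:ℝ)..(2 * π), Real.cos (k * x + c) = 0 := by
  have hk' : (k:ℝ) ≠ 0 := by exact_mod_cast hk
  rw [intervalIntegral.integral_comp_mul_add (fun x => Real.cos x) hk', integral_cos]
  rw [show (k:ℝ) * (2 * π) + c = c + k * (2 * π) by ring, Real.sin_add_nat_mul_two_pi]
  simp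

lemma int_cos_int {k : ℤ} (hk : k ≠ 0) (c : ℝ) : ∫ x in (0:ℝ)..(2 * π), Real.cos (k * x + c) = 0 := by
  have hk' : (k:ℝ) ≠ 0 := by exact_mod_cast hk
  rw [intervalIntegral.integral_comp_mul_add (fun x => Real.cos x) hk', integral_cos]
  rw [show (k:ℝ) * (2 * π) + c = c + k * (2 * π) by ring, Real.sin_add_int_mul_two_pi]
  simp

/-- orthogonality -/
lemma orth {i j : ℕ} (hi : i ≠ 0) (c d : ℝ) :
    ∫ x in (0:ℝ)..(2 * π), Real.cos (i * x + c) * Real.cos (j * x + d) =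
      if i = j then π * Real.cos (c - d) else 0 := by
  have e : ∀ x : ℝ, Real.cos (i * x + c) * Real.cos (j * x + d) =
      1/2 * Real.cos (((i:ℤ) - (j:ℤ) : ℤ) * x + (c - d)) + 1/2 * Real.cos ((i + j : ℕ) * x + (c + d)) := by
    intro x
    push_cast
    rw [show ((i:ℝ) - j) * x + (c - d) = (i * x + c) - (j * x + d) by ring,
      show ((i:ℝ) + j) * x + (c + d) = (i * x + c) + (j * x + d) by ring, Real.cos_add ((i:ℝ) * x + c) ((j:ℝ) * x + d),
      Real.cos_sub ((i:ℝ) * x + c) ((j:ℝ) * x + d)]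
    ring
  simp only [e]
  rw [intervalIntegral.integral_add (Continuous.intervalIntegrable (by fun_prop) _ _)
    (Continuous.intervalIntegrable (by fun_prop) _ _), intervalIntegral.integral_const_mul,
    intervalIntegral.integral_const_mul, int_cos_nat (by omega : i + j ≠ 0)]
  split_ifs with h
  · subst h
    simp
    ring
  · rw [int_cos_int (by omega)]; simp

lemma Hclass_osc {α : ℝ} (hα : α ∈ Set.Ioo (0:ℝ) 1) {φ : ℝ → ℝ}
    (hφ : φ ∈ Hclass (fun t => t ^ α)) (t : ℝ) : |φ t - φ 0| ≤ 2 * π := by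
  obtain ⟨y, hy, hyt⟩ := (show Function.Periodic φ (2 * π) from hφ.2.1).exists_mem_Ico₀ (by positivity) t
  rw [hyt]
  refine (hφ.2.2 y 0).trans ?_
  simp only [sub_zero]
  rw [abs_of_nonneg hy.1]
  calc y ^ α ≤ (2 * π) ^ α := Real.rpow_le_rpow hy.1 hy.2.le hα.1.le
    _ ≤ (2 * π) ^ (1:ℝ) := Real.rpow_le_rpow_of_exponent_le (by linarith [Real.pi_gt_three]) hα.2.le
    _ = _ := Real.rpow_one _

/-- `i`-th harmonic of the convolution -/
def harm (φ : ℝ → ℝ) (q γ : ℝ) (i : ℕ) (x : ℝ) : ℝ :=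
  (1 / π) * ∫ t in (0:ℝ)..(2 * π), φ (x + t) * tmk q γ i t

lemma harm_eq {φ : ℝ → ℝ} (hc : Continuous φ) (hp : ∀ x, φ (x + 2 * π) = φ x) (q γ : ℝ) (i : ℕ) (x : ℝ) :
    harm φ q γ i x =
      q ^ (i+1) * (1/π * ∫ u in (0:ℝ)..(2*π), φ u * Real.cos ((i+1:ℕ) * u + γ)) * Real.cos ((i+1:ℕ) * x) +
      q ^ (i+1) * (1/π * ∫ u in (0:ℝ)..(2*π), φ u * Real.sin ((i+1:ℕ) * u + γ)) * Real.sin ((i+1:ℕ) * x) := by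
  unfold harm
  have h1 : ∫ t in (0:ℝ)..(2 * π), φ (x + t) * tmk q γ i t =
      ∫ u in (0:ℝ)..(2 * π), φ u * tmk q γ i (u - x) := by
    have h2 : Function.Periodic (fun u => φ u * tmk q γ i (u - x)) (2 * π) := by
      intro u
      simp only
      rw [hp]
      unfold tmk
      congr 2
      rw [show ((i+1:ℕ):ℝ) * (u + 2 * π - x) + γ = ((i+1:ℕ):ℝ) * (u - x) + γ + (i+1:ℕ) * (2 * π) by ring,
        Real.cos_add_nat_mul_two_pi]
    have h3 := h2.intervalIntegral_add_eq x 0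
    rw [zero_add] at h3
    rw [← h3]
    have h4 := intervalIntegral.integral_comp_add_left (a := 0) (b := 2 * π)
      (fun u => φ u * tmk q γ i (u - x)) x
    rw [add_zero] at h4
    rw [← h4]
    simp
  rw [h1]
  have h5 : ∀ u, φ u * tmk q γ i (u - x) =
      q ^ (i+1) * Real.cos ((i+1:ℕ) * x) * (φ u * Real.cos ((i+1:ℕ) * u + γ)) +
      q ^ (i+1) * Real.sin ((i+1:ℕ) * x) * (φ u * Real.sin ((i+1:ℕ) * u + γ)) := by
    intro u
    unfold tmk
    rw [show ((i+1:ℕ):ℝ) * (u - x) + γ = ((i+1:ℕ) * u + γ) - (i+1:ℕ) * x by ring, Real.cos_sub]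
    ring
  simp only [h5]
  rw [intervalIntegral.integral_add (Continuous.intervalIntegrable (by fun_prop) _ _)
    (Continuous.intervalIntegrable (by fun_prop) _ _), intervalIntegral.integral_const_mul,
    intervalIntegral.integral_const_mul]
  ring

section fourier

variable {q : ℝ} {φ : ℝ → ℝ} {M : ℝ}

lemma harm_abs (hq0 : 0 < q) (hc : Continuous φ)
    (hM : ∀ x, |φ x| ≤ M) (γ : ℝ) (i : ℕ) (x : ℝ) : |harm φ q γ i x| ≤ 2 * M * q ^ (i+1) := by
  unfold harm
  have := intervalIntegral.norm_integral_le_of_norm_le_const (a := 0) (b := 2 * π)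
    (C := M * q ^ (i+1)) (f := fun t => φ (x + t) * tmk q γ i t) (fun t _ => by
      rw [Real.norm_eq_abs, abs_mul]
      exact mul_le_mul (hM _) (tmk_abs hq0 γ i t) (abs_nonneg _) ((abs_nonneg _).trans (hM 0)))
  rw [Real.norm_eq_abs, sub_zero, abs_of_pos (by positivity : 0 < 2 * π)] at this
  rw [abs_mul, abs_of_pos (by positivity)]
  calc _ ≤ 1 / π * (M * q ^ (i+1) * (2 * π)) := by gcongr
    _ = _ := by field_simp

lemma conv_hasSum (hq0 : 0 < q) (hq1 : q < 1) (hc : Continuous φ)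
    (hM : ∀ x, |φ x| ≤ M) (β x : ℝ) :
    HasSum (fun i => harm φ q (β * π / 2) i x)
      ((1 / π) * ∫ t in (0:ℝ)..(2 * π), φ (x + t) * Pker q β t) := by
  apply HasSum.mul_left
  apply swap hq0 hq1 (M := M)
  · intro i
    have := tmk_cont q (β * π / 2) i
    fun_prop
  · intro i u
    rw [abs_mul]
    exact mul_le_mul (hM _) (tmk_abs hq0 _ i u) (abs_nonneg _) ((abs_nonneg _).trans (hM 0))
  · intro u
    exact (Pker_hasSum hq0 hq1 β u).mul_left _

lemma harm_cont (hc : Continuous φ) (hp : ∀ x, φ (x + 2 * π) = φ x) (γ : ℝ) (i : ℕ) :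
    Continuous (harm φ q γ i) := by
  rw [show harm φ q γ i = fun x => _ from funext fun x => harm_eq hc hp q γ i x]
  fun_prop

lemma harm_orth (hc : Continuous φ) (hp : ∀ x, φ (x + 2 * π) = φ x) (γ : ℝ) (i j : ℕ) (d : ℝ) :
    ∫ x in (0:ℝ)..(2*π), harm φ q γ i x * Real.cos (j * x + d) =
      if i + 1 = j then
      π * (q ^ (i+1) * (1/π * ∫ u in (0:ℝ)..(2*π), φ u * Real.cos ((i+1:ℕ) * u + γ)) * Real.cos d -
      q ^ (i+1) * (1/π * ∫ u in (0:ℝ)..(2*π), φ u * Real.sin ((i+1:ℕ) * u + γ)) * Real.sin d) else 0 := by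
  set a := q ^ (i+1) * (1/π * ∫ u in (0:ℝ)..(2*π), φ u * Real.cos ((i+1:ℕ) * u + γ)) with ha
  set b := q ^ (i+1) * (1/π * ∫ u in (0:ℝ)..(2*π), φ u * Real.sin ((i+1:ℕ) * u + γ)) with hb
  have e : ∀ x, harm φ q γ i x * Real.cos (j * x + d) =
      a * (Real.cos ((i+1:ℕ) * x + 0) * Real.cos (j * x + d)) +
      b * (Real.cos ((i+1:ℕ) * x + (-(π/2))) * Real.cos (j * x + d)) := by
    intro x
    rw [harm_eq hc hp, ← ha, ← hb, ← sub_eq_add_neg, Real.cos_sub_pi_div_two]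
    ring_nf
  simp only [e]
  rw [intervalIntegral.integral_add (Continuous.intervalIntegrable (by fun_prop) _ _)
    (Continuous.intervalIntegrable (by fun_prop) _ _), intervalIntegral.integral_const_mul,
    intervalIntegral.integral_const_mul, orth (by omega), orth (by omega)]
  split_ifs with h
  · rw [zero_sub, Real.cos_neg, show -(π/2) - d = -(d + π/2) by ring, Real.cos_neg, Real.cos_add_pi_div_two]
    ring
  · ring

lemma coef_general (hq0 : 0 < q) (hq1 : q < 1) (hc : Continuous φ) (hp : ∀ x, φ (x + 2 * π) = φ x)
    (hM : ∀ x, |φ x| ≤ M) (β A₀ : ℝ) (j : ℕ) (d : ℝ) :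
    HasSum (fun i => ∫ x in (0:ℝ)..(2*π), harm φ q (β*π/2) i x * Real.cos (j * x + d))
    ((∫ x in (0:ℝ)..(2*π), (A₀ + (1 / π) * ∫ t in (0:ℝ)..(2 * π), φ (x + t) * Pker q β t) *
      Real.cos (j * x + d)) - A₀ * ∫ x in (0:ℝ)..(2*π), Real.cos (j * x + d)) := by
  have hP := Pker_cont hq0 hq1 β
  have hcont : Continuous fun x : ℝ => (1 / π) * ∫ t in (0:ℝ)..(2 * π), φ (x + t) * Pker q β t := by
    apply Continuous.mul continuous_const
    apply intervalIntegral.continuous_parametric_intervalIntegral_of_continuous' (by fun_prop)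
  have e : (∫ x in (0:ℝ)..(2*π), (A₀ + (1 / π) * ∫ t in (0:ℝ)..(2 * π), φ (x + t) * Pker q β t) *
      Real.cos (j * x + d)) - A₀ * (∫ x in (0:ℝ)..(2*π), Real.cos (j * x + d)) =
      ∫ x in (0:ℝ)..(2*π), ((1 / π) * ∫ t in (0:ℝ)..(2 * π), φ (x + t) * Pker q β t) *
      Real.cos (j * x + d) := by
    rw [← intervalIntegral.integral_const_mul, ← intervalIntegral.integral_sub]
    · congr 1; ext x; ring
    · exact Continuous.intervalIntegrable (by fun_prop) _ _
    · exact Continuous.intervalIntegrable (by fun_prop) _ _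
  rw [e]
  apply swap hq0 hq1 (M := 2 * M)
  · intro i
    have := harm_cont (q := q) hc hp (β * π/2) i
    fun_prop
  · intro i u
    rw [abs_mul]
    have h1 := harm_abs hq0 hc hM (β * π/2) i u
    calc _ ≤ 2 * M * q ^ (i+1) * 1 := mul_le_mul h1 (Real.abs_cos_le_one _) (abs_nonneg _)
          ((abs_nonneg _).trans h1)
      _ = _ := mul_one _
  · intro u
    exact (conv_hasSum hq0 hq1 hc hM β u).mul_right _

lemma Ssum_eq (hq0 : 0 < q) (hq1 : q < 1) (hc : Continuous φ) (hp : ∀ x, φ (x + 2 * π) = φ x)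
    (hM : ∀ x, |φ x| ≤ M) (β A₀ : ℝ) (k : ℕ) (x : ℝ) :
    Ssum (fun x => A₀ + (1 / π) * ∫ t in (0:ℝ)..(2 * π), φ (x + t) * Pker q β t) k x =
      A₀ + ∑ i ∈ Finset.range k, harm φ q (β*π/2) i x := by
  have hg := coef_general hq0 hq1 hc hp hM β A₀
  set f := (fun x => A₀ + (1 / π) * ∫ t in (0:ℝ)..(2 * π), φ (x + t) * Pker q β t) with hf
  have h0 : coefA f 0 = 2 * A₀ := by
    have h := hg 0 0
    simp only [harm_orth hc hp] at h
    simp only [Nat.add_eq_zero_iff, one_ne_zero, and_false, if_false] at h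
    have := h.unique hasSum_zero
    unfold coefA
    simp only [Nat.cast_zero, zero_mul, add_zero, Real.cos_zero, mul_one, intervalIntegral.integral_const,
      smul_eq_mul, sub_zero] at this ⊢
    rw [show (∫ t in (0:ℝ)..(2*π), f t) = A₀ * (2 * π) by linarith]
    field_simp
  have hj : ∀ i : ℕ, ∀ d : ℝ, ∫ x in (0:ℝ)..(2*π), f x * Real.cos ((i+1:ℕ) * x + d) =
      π * (q ^ (i+1) * (1/π * ∫ u in (0:ℝ)..(2*π), φ u * Real.cos ((i+1:ℕ) * u + β*π/2)) * Real.cos d -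
      q ^ (i+1) * (1/π * ∫ u in (0:ℝ)..(2*π), φ u * Real.sin ((i+1:ℕ) * u + β*π/2)) * Real.sin d) := by
    intro i d
    have h := hg (i+1) d
    rw [int_cos_nat (by omega), mul_zero, sub_zero] at h
    have h2 := hasSum_single (f := fun i' => ∫ x in (0:ℝ)..(2*π), harm φ q (β*π/2) i' x * Real.cos ((i+1:ℕ) * x + d)) i
      (fun i' hi' => by simp only [harm_orth hc hp]; rw [if_neg (by omega)])
    have h3 := h.unique h2
    rw [harm_orth hc hp, if_pos rfl] at h3
    exact h3
  have hA : ∀ i : ℕ, coefA f (i+1) = q ^ (i+1) * (1/π * ∫ u in (0:ℝ)..(2*π), φ u * Real.cos ((i+1:ℕ) * u + β*π/2)) := by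
    intro i
    have := hj i 0
    simp only [add_zero, Real.cos_zero, Real.sin_zero, mul_one, mul_zero, sub_zero] at this
    unfold coefA
    rw [this, ← mul_assoc (1/π) π, one_div_mul_cancel Real.pi_ne_zero, one_mul]
  have hB : ∀ i : ℕ, coefB f (i+1) = q ^ (i+1) * (1/π * ∫ u in (0:ℝ)..(2*π), φ u * Real.sin ((i+1:ℕ) * u + β*π/2)) := by
    intro i
    have := hj i (-(π/2))
    simp only [← sub_eq_add_neg, Real.cos_sub_pi_div_two, Real.cos_neg, Real.cos_pi_div_two, Real.sin_neg,
      Real.sin_pi_div_two, mul_zero, zero_sub, mul_neg, mul_one, neg_neg] at this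
    unfold coefB
    rw [this, ← mul_assoc (1/π) π, one_div_mul_cancel Real.pi_ne_zero, one_mul]
  unfold Ssum
  rw [h0, ← Finset.Ico_add_one_right_eq_Icc, Finset.sum_Ico_eq_sum_range]
  simp only [Nat.add_sub_cancel]
  congr 1
  · ring
  · apply Finset.sum_congr rfl
    intro i _
    rw [add_comm 1 i, hA, hB, harm_eq hc hp]

lemma diff_eq (hq0 : 0 < q) (hq1 : q < 1) (hc : Continuous φ) (hp : ∀ x, φ (x + 2 * π) = φ x)
    (hM : ∀ x, |φ x| ≤ M) (β A₀ : ℝ) (k : ℕ) (x : ℝ) :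
    (A₀ + (1 / π) * ∫ t in (0:ℝ)..(2 * π), φ (x + t) * Pker q β t) -
    Ssum (fun x => A₀ + (1 / π) * ∫ t in (0:ℝ)..(2 * π), φ (x + t) * Pker q β t) k x =
      (1 / π) * ∫ t in (0:ℝ)..(2 * π), φ (x + t) * tailk q β k t := by
  rw [Ssum_eq hq0 hq1 hc hp hM]
  unfold tailk harm
  have hP := Pker_cont hq0 hq1 β
  have ht := tmk_cont q (β * π / 2)
  simp only [mul_sub, Finset.mul_sum]
  rw [intervalIntegral.integral_sub, intervalIntegral.integral_finsetSum, mul_sub, Finset.mul_sum]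
  · ring
  · intro i _
    exact Continuous.intervalIntegrable (by fun_prop) _ _
  · exact Continuous.intervalIntegrable (by fun_prop) _ _
  · exact Continuous.intervalIntegrable (by fun_prop) _ _

lemma tailk_cont (hq0 : 0 < q) (hq1 : q < 1) (β : ℝ) (k : ℕ) : Continuous (tailk q β k) := by
  have hP := Pker_cont hq0 hq1 β
  have ht := tmk_cont q (β * π / 2)
  unfold tailk
  fun_prop

lemma tailk_int (hq0 : 0 < q) (hq1 : q < 1) (β : ℝ) (k : ℕ) :
    ∫ t in (0:ℝ)..(2 * π), tailk q β k t = 0 := by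
  have hP := Pker_cont hq0 hq1 β
  have ht := tmk_cont q (β * π / 2)
  have hz : ∀ i, ∫ t in (0:ℝ)..(2 * π), tmk q (β * π / 2) i t = 0 := by
    intro i
    unfold tmk
    rw [intervalIntegral.integral_const_mul, int_cos_nat (by omega), mul_zero]
  have h := swap hq0 hq1 (M := 1) ht (fun i u => by rw [one_mul]; exact tmk_abs hq0 _ i u)
    (fun u => Pker_hasSum hq0 hq1 β u) 0 (2 * π)
  simp only [hz] at h
  unfold tailk
  rw [intervalIntegral.integral_sub, intervalIntegral.integral_finsetSum, h.unique hasSum_zero]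
  · simp [hz]
  · intro i _
    exact Continuous.intervalIntegrable (by fun_prop) _ _
  · exact Continuous.intervalIntegrable (by fun_prop) _ _
  · exact Continuous.intervalIntegrable (by fun_prop) _ _

lemma sum_tail (hq0 : 0 < q) (hq1 : q < 1) (β : ℝ) {n p : ℕ} (hpn : p < n) (t : ℝ) :
    ∑ k ∈ Finset.Ico (n - p) n, tailk q β k t =
      q ^ (n - p + 1) * (Rk q p t * Real.cos (Yk q (β * π / 2) (n - p + 1) p t)) := by
  rw [← kernel_polar hq0 hq1]
  simp only [tailk_re hq0 hq1]
  rw [← Complex.re_sum]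
  congr 1
  have hZ1 : (1 - (q:ℂ) * Complex.exp (t * Complex.I)) ≠ 0 := wf_ne hq0.le hq1 t
  set Z := (q:ℂ) * Complex.exp (t * Complex.I) with hZ
  rw [Finset.sum_Ico_eq_sum_range, show n - (n - p) = p by omega]
  have hg := mul_neg_geom_sum Z p
  rw [← hg, ← Finset.sum_div, eq_div_iff (pow_ne_zero 2 hZ1), pow_two, ← mul_assoc, div_mul_cancel₀ _ hZ1,
    Finset.mul_sum, Finset.mul_sum, Finset.sum_mul]
  apply Finset.sum_congr rfl
  intro i _
  rw [show n - p + i + 1 = (n - p + 1) + i by ring, pow_add]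
  ring

lemma dev_eq (hq0 : 0 < q) (hq1 : q < 1) (hc : Continuous φ) (hp : ∀ x, φ (x + 2 * π) = φ x)
    (hM : ∀ x, |φ x| ≤ M) (β A₀ : ℝ) {n p : ℕ} (hp1 : 1 ≤ p) (hpn : p < n) (x : ℝ) :
    (A₀ + (1 / π) * ∫ t in (0:ℝ)..(2 * π), φ (x + t) * Pker q β t) -
    Vsum n p (fun x => A₀ + (1 / π) * ∫ t in (0:ℝ)..(2 * π), φ (x + t) * Pker q β t) x =
      q ^ (n - p + 1) / (π * p) *
        ∫ t in (0:ℝ)..(2 * π), φ (x + t) * (Rk q p t * Real.cos (Yk q (β * π / 2) (n - p + 1) p t)) := by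
  have hp0 : (p:ℝ) ≠ 0 := by positivity
  have hd := fun k => diff_eq hq0 hq1 hc hp hM β A₀ k x
  set f := (fun x => A₀ + (1 / π) * ∫ t in (0:ℝ)..(2 * π), φ (x + t) * Pker q β t) with hf
  have hfx : (A₀ + (1 / π) * ∫ t in (0:ℝ)..(2 * π), φ (x + t) * Pker q β t) = f x := rfl
  rw [hfx] at hd ⊢
  have h1 : f x - Vsum n p f x = 1 / (p:ℝ) * ∑ k ∈ Finset.Ico (n - p) n, (f x - Ssum f k x) := by
    unfold Vsum
    rw [Finset.sum_sub_distrib, Finset.sum_const, Nat.card_Ico, show n - (n - p) = p by omega, nsmul_eq_mul]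
    field_simp
  rw [h1]
  simp only [hd]
  rw [← Finset.mul_sum, ← intervalIntegral.integral_finsetSum]
  · simp only [← Finset.mul_sum, sum_tail hq0 hq1 β hpn]
    have : ∀ t, φ (x + t) * (q ^ (n - p + 1) * (Rk q p t * Real.cos (Yk q (β * π / 2) (n - p + 1) p t))) =
      q ^ (n - p + 1) * (φ (x + t) * (Rk q p t * Real.cos (Yk q (β * π / 2) (n - p + 1) p t))) := fun t => by ring
    simp only [this]
    rw [intervalIntegral.integral_const_mul]
    field_simp
  · intro k _
    have := tailk_cont hq0 hq1 β k
    exact Continuous.intervalIntegrable (by fun_prop) _ _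

lemma kern_int (hq0 : 0 < q) (hq1 : q < 1) (β : ℝ) {n p : ℕ} (hpn : p < n) :
    ∫ t in (0:ℝ)..(2 * π), (Rk q p t * Real.cos (Yk q (β * π / 2) (n - p + 1) p t)) = 0 := by
  have h : ∫ t in (0:ℝ)..(2 * π), ∑ k ∈ Finset.Ico (n - p) n, tailk q β k t = 0 := by
    rw [intervalIntegral.integral_finsetSum]
    · simp [tailk_int hq0 hq1]
    · intro k _
      exact (tailk_cont hq0 hq1 β k).intervalIntegrable _ _
  simp only [sum_tail hq0 hq1 β hpn] at h
  rw [intervalIntegral.integral_const_mul] at h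
  exact (mul_eq_zero.1 h).resolve_left (by positivity)

end fourier

lemma eInt_holder {α : ℝ} (m : ℕ) :
    eInt m (fun t => t ^ α) =
      (2:ℝ) ^ α / (m:ℝ) ^ α * ∫ t in (0:ℝ)..(π / 2), t ^ α * Real.sin t := by
  unfold eInt
  rw [← intervalIntegral.integral_const_mul]
  apply intervalIntegral.integral_congr
  intro t ht
  rw [Set.uIcc_of_le (by positivity)] at ht
  simp only
  rw [Real.div_rpow (by linarith [ht.1]) (by positivity), Real.mul_rpow (by norm_num) ht.1]
  ring

/-- constant in the upper estimate -/
def Cup : ℝ := 2 * (2 * π) * (4 * π) ^ 2 + (2 * π) * (4 * π) + 2 * (4 * π) + 2 * (4 * π) ^ 2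

/-- constant in the lower estimate -/
def Clow : ℝ := (π * (4 * π + 1) * (4 * π) + 4 * ((4 * π) ^ 2 + 4 * π)) / 2 + 4 * π

lemma upper_abs {q α β : ℝ} {n p : ℕ} (hq0 : 0 < q) (hq1 : q < 1) (hα : α ∈ Set.Ioo (0:ℝ) 1)
    (hp1 : 1 ≤ p) (hpn : p < n) (hm : 6 / (1 - q) ≤ ((n - p + 1 : ℕ) : ℝ))
    {φ : ℝ → ℝ} (hφ : φ ∈ Hclass (fun t => t ^ α)) (x : ℝ) :
    |∫ t in (0:ℝ)..(2 * π), φ (x + t) * (Rk q p t * Real.cos (Yk q (β * π / 2) (n - p + 1) p t))| ≤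
      eInt (n - p + 1) (fun t => t ^ α) / π * Kpq p q +
        Cup * (3 / (1 - q) ^ δp p) / ((n - p + 1 : ℕ) : ℝ) := by
  have h := phaseData hq0 hq1 (β * π / 2) hp1 hm
  have hRc := h.Rcont
  have hYc := h.Ycont
  have hφc := hφ.1
  have key : ∀ ψ ∈ Hclass (fun t : ℝ => t ^ α), 
      ∫ t in (0:ℝ)..(2 * π), ψ (x + t) * (Rk q p t * Real.cos (Yk q (β * π / 2) (n - p + 1) p t)) ≤
      eInt (n - p + 1) (fun t => t ^ α) / π * Kpq p q +
        Cup * (3 / (1 - q) ^ δp p) / ((n - p + 1 : ℕ) : ℝ) := by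
    intro ψ hψ
    have hψc := hψ.1
    have hs : (fun t => ψ (x + t) - ψ x) ∈ Hclass (fun t : ℝ => t ^ α) := by
      refine ⟨by fun_prop, fun t => ?_, fun s t => ?_⟩
      · simp only; rw [← add_assoc, hψ.2.1]
      · have := hψ.2.2 (x + s) (x + t)
        simpa using this
    have hb : ∀ t, |(fun t => ψ (x + t) - ψ x) t| ≤ 2 * π := by
      intro t
      have := Hclass_osc hα hs t
      simpa using this
    have hu := h.upper hα hs hb
    rw [Rk_int] at hu
    have e : ∫ t in (0:ℝ)..(2 * π), (fun t => ψ (x + t) - ψ x) t *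
        (Rk q p t * Real.cos (Yk q (β * π / 2) (n - p + 1) p t)) =
        ∫ t in (0:ℝ)..(2 * π), ψ (x + t) * (Rk q p t * Real.cos (Yk q (β * π / 2) (n - p + 1) p t)) := by
      simp only [sub_mul]
      rw [intervalIntegral.integral_sub (Continuous.intervalIntegrable (by fun_prop) _ _)
        (Continuous.intervalIntegrable (by fun_prop) _ _), intervalIntegral.integral_const_mul,
        kern_int hq0 hq1 β hpn, mul_zero, sub_zero]
    rw [e] at hu
    exact hu
  rw [abs_le']
  refine ⟨key φ hφ, ?_⟩
  have hneg : (fun t => - φ t) ∈ Hclass (fun t : ℝ => t ^ α) := by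
    refine ⟨by fun_prop, fun t => ?_, fun s t => ?_⟩
    · simp only; rw [hφ.2.1]
    · have := hφ.2.2 t s
      rw [abs_sub_comm t s] at this
      calc _ = |φ t - φ s| := by congr 1; ring
        _ ≤ _ := this
  have := key _ hneg
  simpa only [neg_mul, intervalIntegral.integral_neg] using this

lemma zero_case (q β α : ℝ) (hα : α ∈ Set.Ioo (0:ℝ) 1) (n : ℕ) :
    Edev (CqbH q β (fun t => t ^ α)) (Vsum n 0) = 0 := by
  unfold Edev
  apply Real.iSup_of_not_bddAbove
  rintro ⟨B, hB⟩
  have hz : (fun _ : ℝ => (0:ℝ)) ∈ Hclass (fun t : ℝ => t ^ α) := by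
    refine ⟨continuous_const, fun _ => rfl, fun s t => ?_⟩
    simp only [sub_self, abs_zero]
    exact Real.rpow_nonneg (abs_nonneg _) _
  have hf : (fun _ : ℝ => |B| + 1) ∈ CqbH q β (fun t => t ^ α) :=
    ⟨|B| + 1, _, hz, by simp⟩
  have := hB ⟨⟨_, hf⟩, rfl⟩
  simp only [Vsum, Nat.cast_zero, div_zero, zero_mul, sub_zero, ciSup_const] at this
  rw [abs_of_nonneg (by positivity)] at this
  linarith [le_abs_self B]

lemma main_case {q α β : ℝ} {n p : ℕ} (hq0 : 0 < q) (hq1 : q < 1) (hα : α ∈ Set.Ioo (0:ℝ) 1)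
    (hp1 : 1 ≤ p) (hpn : p < n) (hm : 6 / (1 - q) ≤ ((n - p + 1 : ℕ) : ℝ)) :
    q ^ (n - p + 1) / (π * p) * (eInt (n - p + 1) (fun t => t ^ α) / π * Kpq p q -
        Clow * (3 / (1 - q) ^ δp p) / ((n - p + 1 : ℕ) : ℝ)) ≤
      Edev (CqbH q β (fun t => t ^ α)) (Vsum n p) ∧
    Edev (CqbH q β (fun t => t ^ α)) (Vsum n p) ≤
      q ^ (n - p + 1) / (π * p) * (eInt (n - p + 1) (fun t => t ^ α) / π * Kpq p q +
        Cup * (3 / (1 - q) ^ δp p) / ((n - p + 1 : ℕ) : ℝ)) := by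
  have hbd : ∀ φ ∈ Hclass (fun t : ℝ => t ^ α), ∀ t, |φ t| ≤ |φ 0| + 2 * π := by
    intro φ hφ t
    have h1 := Hclass_osc hα hφ t
    have h2 := abs_add_le (φ t - φ 0) (φ 0)
    rw [sub_add_cancel] at h2
    linarith
  have hu : ∀ f : CqbH q β (fun t => t ^ α), ∀ x : ℝ, |(f : ℝ → ℝ) x - Vsum n p f x| ≤
      q ^ (n - p + 1) / (π * p) * (eInt (n - p + 1) (fun t => t ^ α) / π * Kpq p q +
        Cup * (3 / (1 - q) ^ δp p) / ((n - p + 1 : ℕ) : ℝ)) := by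
    rintro ⟨f, A₀, φ, hφ, rfl⟩ x
    simp only
    rw [dev_eq hq0 hq1 hφ.1 hφ.2.1 (hbd φ hφ) β A₀ hp1 hpn x, abs_mul, abs_of_pos (by positivity)]
    gcongr
    exact upper_abs hq0 hq1 hα hp1 hpn hm hφ x
  obtain ⟨φ, hφ, hl⟩ := (phaseData hq0 hq1 (β * π / 2) hp1 hm).lower hα
  rw [Rk_int] at hl
  have hf : (fun x => 0 + (1 / π) * ∫ t in (0:ℝ)..(2 * π), φ (x + t) * Pker q β t) ∈
      CqbH q β (fun t => t ^ α) := ⟨0, φ, hφ, rfl⟩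
  unfold Edev
  constructor
  · have h1 := dev_eq hq0 hq1 hφ.1 hφ.2.1 (hbd φ hφ) β 0 hp1 hpn 0
    simp only [zero_add] at h1 hf
    have hb1 : BddAbove (Set.range fun f : CqbH q β (fun t => t ^ α) =>
        ⨆ x : ℝ, |(f : ℝ → ℝ) x - Vsum n p f x|) :=
      ⟨_, by rintro _ ⟨f, rfl⟩; exact ciSup_le (hu f)⟩
    refine le_trans ?_ (le_ciSup hb1 ⟨_, hf⟩)
    refine le_trans ?_ (le_ciSup (f := fun x : ℝ => |_|) ⟨_, by rintro _ ⟨x, rfl⟩; exact hu ⟨_, hf⟩ x⟩ 0)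
    refine le_trans ?_ (le_abs_self _)
    simp only [zero_add]
    rw [h1]
    gcongr
    exact hl
  · haveI : Nonempty (CqbH q β (fun t => t ^ α)) := ⟨⟨_, hf⟩⟩
    exact ciSup_le fun f => ciSup_le (hu f)

/-- **Theorem 2** (Serdyuk–Ovsii): the Kolmogorov–Nikol'skii problem for de la Vallée
Poussin sums on the classes `C^q_β H^α`, `0 < α < 1`, where `H^α = H_ω` with `ω(t) = t^α`. -/
theorem vallee_poussin_Holder :
    ∃ C : ℝ, 0 < C ∧
      ∀ (q β α : ℝ) (n p : ℕ),
        q ∈ Set.Ioo (0:ℝ) 1 → α ∈ Set.Ioo (0:ℝ) 1 → p < n →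
        6 / (1 - q) ≤ (n : ℝ) - (p : ℝ) →
        |Edev (CqbH q β (fun t => t ^ α)) (Vsum n p) -
            q ^ (n - p + 1) / ((p : ℝ) * ((n - p + 1 : ℕ) : ℝ) ^ α) *
              ((2:ℝ) ^ α / π ^ 2) * Kpq p q *
                ∫ t in (0:ℝ)..(π / 2), t ^ α * Real.sin t| ≤
          C * q ^ (n - p + 1) /
            ((p : ℝ) * ((n - p + 1 : ℕ) : ℝ) * (1 - q) ^ δp p) := by
  have hCup : 0 < Cup := by unfold Cup; positivity
  have hClow : 0 < Clow := by unfold Clow; positivity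
  refine ⟨3 / π * (Cup + Clow), by positivity, ?_⟩
  intro q β α n p hq hα hpn hnp
  rcases Nat.eq_zero_or_pos p with rfl | hp1
  · rw [zero_case q β α hα n]
    simp
  have hq0 := hq.1
  have hd : 0 < 1 - q := by linarith [hq.2]
  have hp0 : (0:ℝ) < p := by exact_mod_cast hp1
  have hm : 6 / (1 - q) ≤ ((n - p + 1 : ℕ) : ℝ) := by
    push_cast [Nat.cast_sub hpn.le]
    linarith
  obtain ⟨hl, hu⟩ := main_case (β := β) hq.1 hq.2 hα hp1 hpn hm
  have hm0 : (0:ℝ) < ((n - p + 1 : ℕ) : ℝ) := by positivity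
  rw [eInt_holder] at hl hu
  generalize Edev (CqbH q β (fun t => t ^ α)) (Vsum n p) = E at *
  generalize ((n - p + 1 : ℕ) : ℝ) = m at *
  generalize (∫ t in (0:ℝ)..(π / 2), t ^ α * Real.sin t) = I at *
  generalize Kpq p q = K at *
  have hma : 0 < m ^ α := by positivity
  have hdd : 0 < (1 - q) ^ δp p := by positivity
  have hQ : 0 < q ^ (n - p + 1) := by positivity
  generalize q ^ (n - p + 1) = Q at *
  generalize (1 - q) ^ δp p = D at *
  generalize m ^ α = ma at *
  generalize (2:ℝ) ^ α = ta at *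
  have e : ∀ c, Q / (π * p) * (ta / ma * I / π * K + c * (3 / D) / m) =
      Q / (p * ma) * (ta / π ^ 2) * K * I + 3 / π * c * Q / (p * m * D) := by
    intro c
    field_simp
  have hc : ∀ c, 0 < c → 0 < 3 / π * c * Q / (p * m * D) := fun c hc => by positivity
  have e2 := e (-Clow)
  rw [e Cup] at hu
  rw [show ta / ma * I / π * K - Clow * (3 / D) / m = ta / ma * I / π * K + -Clow * (3 / D) / m by ring,
    e2] at hl
  have h1 := hc _ hCup
  have h2 := hc _ hClow
  rw [show 3 / π * (Cup + Clow) * Q / (p * m * D) =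
    3 / π * Cup * Q / (p * m * D) + 3 / π * Clow * Q / (p * m * D) by ring]
  rw [show 3 / π * -Clow * Q / (p * m * D) = -(3 / π * Clow * Q / (p * m * D)) by ring] at hl
  rw [abs_le]
  constructor <;> linarith
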